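/- arXiv:1211.1848 — 3 statements merged into one kernel-verified Lean document; each statement's English description precedes it below -/
import Mathlib

section
/- Let n ≥ 2 and let P be a nonzero harmonic homogeneous polynomial of degree N on ℝⁿ with complex coefficients, with associated polynomial Q ∈ ℂ[η₁,…,η_n]. If n ≥ 3, then for every nonempty subset W of {ρ ∈ ℂⁿ : ρ·ρ = 0 and ρ_j ≠ 0 for all j} that is open in the subspace topology of the variety {ρ·ρ = 0}, the function ρ ↦ Q(1/ρ) does not vanish identically on W. If n = 2, then ρ ↦ Q(1/ρ) cannot vanish identically on both a nonempty relatively open subset of {ρ ∈ ℂ² : ρ₁ = iρ₂, ρ₁ρ₂ ≠ 0} and a nonempty relatively open subset of {ρ ∈ ℂ² : ρ₁ = −iρ₂, ρ₁ρ₂ ≠ 0}. -/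
open MvPolynomial

/-- The polynomial `Q(η) = Σ_{|α|=N} α! p_α η^{α+1}` associated to a polynomial
`P(x) = Σ p_α x^α`; it represents the Laplace transform of `P` over the positive
orthant via `P̂(ρ) = Q(1/ρ)`. -/
noncomputable def assocPoly (n : ℕ) (P : MvPolynomial (Fin n) ℂ) : MvPolynomial (Fin n) ℂ :=
  ∑ α ∈ P.support,
    monomial (α + Finsupp.equivFunOnFinite.symm fun _ => 1)
      ((∏ j, ((α j).factorial : ℂ)) * P.coeff α)

theorem comb_vanish {n : ℕ} (i0 i1 : Fin n) (h01 : i0 ≠ i1)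
    (c u : (Fin n →₀ ℕ) → ℂ)
    (hu0 : ∀ β, β i0 < 2 → u β = 0) (hu1 : ∀ β, β i1 < 2 → u β = 0)
    (hc : ∀ α, c α = ∑ j, u (α + Finsupp.single j 2))
    (hh : ∀ α, ∑ j, c (α + Finsupp.single j 2) = 0) : ∀ α, c α = 0 := by
  have key : ∀ i : Fin n, (∀ β, β i < 2 → u β = 0) →
      ∀ α, u (α + Finsupp.single i 2) = ((α i / 2 : ℕ) + 1) * c α := by
    intro i hui
    have H : ∀ m : ℕ, ∀ α : Fin n →₀ ℕ, α i = m →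
        u (α + Finsupp.single i 2) = ((α i / 2 : ℕ) + 1) * c α := by
      intro m
      induction m using Nat.strong_induction_on with
      | _ m ih =>
        intro α hα
        have e1 := hc α
        rw [← Finset.add_sum_erase _ _ (Finset.mem_univ i)] at e1
        by_cases hm : m < 2
        · have : ∑ x ∈ Finset.univ.erase i, u (α + Finsupp.single x 2) = 0 := by
            apply Finset.sum_eq_zero
            intro x hx
            apply hui
            have : x ≠ i := Finset.ne_of_mem_erase hx
            simp [this, hα, hm]
          rw [this] at e1
          have h2 : α i / 2 = 0 := by omega
          rw [h2, e1]; simp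
        · push Not at hm
          obtain ⟨γ, rfl⟩ : ∃ γ, α = γ + Finsupp.single i 2 := by
            refine ⟨α - Finsupp.single i 2, ?_⟩
            rw [tsub_add_cancel_of_le]
            simp only [Finsupp.single_le_iff]; omega
          simp only [Finsupp.add_apply, Finsupp.single_eq_same] at hα ⊢
          have e2 := hh γ
          rw [← Finset.add_sum_erase _ _ (Finset.mem_univ i)] at e2
          have : ∑ x ∈ Finset.univ.erase i, u (γ + Finsupp.single i 2 + Finsupp.single x 2)
              = ((γ i / 2 : ℕ) + 1) * ∑ x ∈ Finset.univ.erase i, c (γ + Finsupp.single x 2) := by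
            rw [Finset.mul_sum]
            apply Finset.sum_congr rfl
            intro x hx
            have hx : x ≠ i := Finset.ne_of_mem_erase hx
            have := ih (γ i) (by omega) (γ + Finsupp.single x 2) (by simp [hx])
            rw [add_right_comm, this]
            simp [hx]
          rw [this] at e1
          have h2 : (γ i + 2) / 2 = γ i / 2 + 1 := by omega
          rw [h2]
          push_cast
          linear_combination (-1 : ℂ) * e1 - ((γ i / 2 : ℕ) + 1) * e2
    intro α
    exact H _ α rfl
  have k0 := key i0 hu0
  have k1 := key i1 hu1
  have H : ∀ m : ℕ, ∀ α : Fin n →₀ ℕ, α i1 = m → c α = 0 := by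
    intro m
    induction m using Nat.strong_induction_on with
    | _ m ih =>
      intro α hα
      have h0 := k0 α
      have hne : (((α i0 / 2 : ℕ) : ℂ) + 1) ≠ 0 := Nat.cast_add_one_ne_zero _
      suffices u (α + Finsupp.single i0 2) = 0 by
        rw [this] at h0
        rcases mul_eq_zero.1 h0.symm with h | h
        · exact absurd h hne
        · exact h
      by_cases hm : m < 2
      · apply hu1; simp [h01, hα, hm]
      · push Not at hm
        obtain ⟨γ, rfl⟩ : ∃ γ, α = γ + Finsupp.single i1 2 := by
          refine ⟨α - Finsupp.single i1 2, ?_⟩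
          rw [tsub_add_cancel_of_le]
          simp only [Finsupp.single_le_iff]; omega
        simp only [Finsupp.add_apply, Finsupp.single_eq_same] at hα
        rw [add_right_comm, k1, ih (γ i1) (by omega) _ (by simp [h01]), mul_zero]
  intro α
  exact H _ α rfl

theorem zero_of_eventually {m : ℕ} (p : MvPolynomial (Fin m) ℂ) (y : Fin m → ℂ)
    (h : ∀ᶠ z in nhds y, eval z p = 0) : p = 0 := by
  obtain ⟨ε, hε, hb⟩ := Metric.eventually_nhds_iff_ball.1 h
  apply MvPolynomial.funext_set (fun j => Metric.ball (y j) ε)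
  · intro j
    exact infinite_of_mem_nhds (y j) (Metric.ball_mem_nhds _ hε)
  · intro x hx
    rw [map_zero]
    apply hb
    rw [ball_pi _ hε]
    exact hx

theorem not_square {k : ℕ} (A B : MvPolynomial (Fin (k+2)) ℂ)
    (h : B ^ 2 + A ^ 2 * ∑ j, X j ^ 2 = 0) : A = 0 := by
  by_contra hA
  have hq : (∑ j : Fin (k+1), (X j.succ : MvPolynomial (Fin (k+2)) ℂ) ^ 2) ≠ 0 := by
    intro h0
    have := congrArg (eval (Pi.single 1 1)) h0
    rw [Fin.sum_univ_succ] at this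
    simp [Pi.single_apply] at this
    norm_cast at this
    omega
  have hne := mul_ne_zero hA hq
  obtain ⟨a, ha⟩ : ∃ a, eval a (A * (∑ j : Fin (k+1), (X j.succ) ^ 2)) ≠ 0 := by
    by_contra! hcon
    exact hne (MvPolynomial.funext fun x => by simpa using hcon x)
  rw [map_mul] at ha
  have ha1 := left_ne_zero_of_mul ha
  have ha2 := right_ne_zero_of_mul ha
  let ψ : MvPolynomial (Fin (k+2)) ℂ →ₐ[ℂ] Polynomial ℂ :=
    aeval (Fin.cons Polynomial.X (fun j => Polynomial.C (a j.succ)))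
  have hψ : ∀ p, Polynomial.eval (a 0) (ψ p) = eval a p := by
    intro p
    have : (Polynomial.aeval (a 0)).comp ψ = aeval a := by
      apply MvPolynomial.algHom_ext
      intro i
      refine Fin.cases ?_ (fun j => ?_) i <;> simp [ψ]
    have := DFunLike.congr_fun this p
    rw [AlgHom.comp_apply, Polynomial.coe_aeval_eq_eval] at this
    rw [this, ← MvPolynomial.coe_aeval_eq_eval]; rfl
  have hA' : ψ A ≠ 0 := by
    intro h0
    have := hψ A
    rw [h0] at this
    exact ha1 (by simpa using this.symm)
  set cc := eval a (∑ j : Fin (k+1), (X j.succ : MvPolynomial (Fin (k+2)) ℂ) ^ 2) with hcc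
  obtain ⟨s, hs⟩ : ∃ s : ℂ, s ^ 2 = -cc := IsAlgClosed.exists_pow_nat_eq _ (by norm_num)
  have hs0 : s ≠ 0 := by
    rintro rfl
    apply ha2; simpa using hs.symm
  have hq' : ψ (∑ j, X j ^ 2) = (Polynomial.X - Polynomial.C s) * (Polynomial.X - Polynomial.C (-s)) := by
    have : cc = - s^2 := by rw [hs]; ring
    have h3 : ψ (∑ j, X j ^ 2) = Polynomial.X ^ 2 + Polynomial.C cc := by
      rw [Fin.sum_univ_succ]; simp [ψ, hcc]
    rw [h3, this]; simp; ring
  have e := congrArg ψ h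
  rw [map_add, map_mul, hq', map_pow, map_pow, map_zero] at e
  have e' : ψ B ^ 2 = (-1 : Polynomial ℂ) * (ψ A ^ 2 * ((Polynomial.X - Polynomial.C s) * (Polynomial.X - Polynomial.C (-s)))) := by
    linear_combination e
  have hqne : (Polynomial.X - Polynomial.C s) * (Polynomial.X - Polynomial.C (-s)) ≠ 0 :=
    mul_ne_zero (Polynomial.X_sub_C_ne_zero _) (Polynomial.X_sub_C_ne_zero _)
  have hA2 : ψ A ^ 2 ≠ 0 := pow_ne_zero _ hA'
  have e2 := congrArg (fun p => Multiset.count s p.roots) e'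
  rw [neg_one_mul, Polynomial.roots_neg, Polynomial.roots_mul (mul_ne_zero hA2 hqne), Polynomial.roots_mul hqne,
    Polynomial.roots_pow, Polynomial.roots_pow, Polynomial.roots_X_sub_C, Polynomial.roots_X_sub_C] at e2
  have : s ≠ -s := by
    intro h; apply hs0; linear_combination h / 2
  simp [Multiset.count_singleton, this] at e2
  omega

/-- the reversed polynomial -/
noncomputable def revPoly (n N : ℕ) (P : MvPolynomial (Fin n) ℂ) : MvPolynomial (Fin n) ℂ :=
  ∑ α ∈ P.support,
    monomial (Finsupp.equivFunOnFinite.symm fun j => N - α j)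
      ((∏ j, ((α j).factorial : ℂ)) * P.coeff α)

theorem le_of_hom {n N : ℕ} {P : MvPolynomial (Fin n) ℂ} (h : P.IsHomogeneous N)
    {α : Fin n →₀ ℕ} (hα : α ∈ P.support) (j : Fin n) : α j ≤ N := by
  have h1 : α.degree = N := by
    have := h (mem_support_iff.1 hα)
    rw [Finsupp.degree_eq_weight_one]; exact this
  rw [← h1]
  exact Finsupp.le_degree j α

theorem eval_revPoly {n N : ℕ} {P : MvPolynomial (Fin n) ℂ} (h : P.IsHomogeneous N)
    (ρ : Fin n → ℂ) (hρ : ∀ j, ρ j ≠ 0)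
    (h0 : eval (fun j => (ρ j)⁻¹) (assocPoly n P) = 0) : eval ρ (revPoly n N P) = 0 := by
  have : eval ρ (revPoly n N P) =
      (∏ j, ρ j ^ (N+1)) * eval (fun j => (ρ j)⁻¹) (assocPoly n P) := by
    unfold revPoly assocPoly
    rw [map_sum, map_sum, Finset.mul_sum]
    apply Finset.sum_congr rfl
    intro α hα
    rw [eval_monomial, eval_monomial, Finsupp.prod_fintype _ _ (by simp),
      Finsupp.prod_fintype _ _ (by simp), mul_left_comm, ← Finset.prod_mul_distrib]
    congr 1
    apply Finset.prod_congr rfl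
    intro j _
    have hj := le_of_hom h hα j
    simp only [Finsupp.equivFunOnFinite_symm_apply_apply, Finsupp.add_apply]
    have : N + 1 = (N - α j) + (α j + 1) := by omega
    rw [this, pow_add, mul_assoc, ← mul_pow, mul_inv_cancel₀ (hρ j), one_pow, mul_one]
  rw [this, h0, mul_zero]

theorem coeff_revPoly {n N : ℕ} {P : MvPolynomial (Fin n) ℂ} (h : P.IsHomogeneous N)
    (α : Fin n →₀ ℕ) (hα : ∀ j, α j ≤ N) :
    coeff (Finsupp.equivFunOnFinite.symm fun j => N - α j) (revPoly n N P) =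
      (∏ j, ((α j).factorial : ℂ)) * P.coeff α := by
  unfold revPoly
  rw [coeff_sum, Finset.sum_eq_single α]
  · simp
  · intro β hβ hne
    rw [coeff_monomial, if_neg]
    intro he
    apply hne
    ext j
    have := DFunLike.congr_fun he j
    simp only [Finsupp.equivFunOnFinite_symm_apply_apply] at this
    have h1 := le_of_hom h hβ j
    have h2 := hα j
    omega
  · intro hn
    rw [notMem_support_iff.1 hn]; simp

theorem degreeOf_revPoly {n N : ℕ} (P : MvPolynomial (Fin n) ℂ) (i : Fin n) :
    degreeOf i (revPoly n N P) ≤ N := by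
  rw [degreeOf_le_iff]
  intro m hm
  by_contra! hcon
  rw [mem_support_iff] at hm
  apply hm
  unfold revPoly
  rw [coeff_sum]
  apply Finset.sum_eq_zero
  intro β _
  rw [coeff_monomial, if_neg]
  rintro rfl
  simp only [Finsupp.equivFunOnFinite_symm_apply_apply] at hcon
  omega

theorem not_dvd_rev {n N : ℕ} (hn : 2 ≤ n) (P : MvPolynomial (Fin n) ℂ)
    (hP0 : P ≠ 0) (hPhom : P.IsHomogeneous N)
    (hPharm : ∑ j : Fin n, pderiv j (pderiv j P) = 0)
    (hd : (∑ j, X j ^ 2) ∣ revPoly n N P) : False := by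
  obtain ⟨S, hS⟩ := hd
  have hqc : ∀ i : Fin n, coeff (Finsupp.single i 2) (∑ j, (X j : MvPolynomial (Fin n) ℂ) ^ 2) = 1 := by
    intro i
    rw [coeff_sum, Finset.sum_eq_single i]
    · simp [X_pow_eq_monomial]
    · intro b _ hb
      rw [X_pow_eq_monomial, coeff_monomial, if_neg]
      intro he
      have := DFunLike.congr_fun he b
      simp [hb] at this
    · simp
  have hSdeg : ∀ (i : Fin n) δ, coeff δ S ≠ 0 → δ i + 2 ≤ N := by
    intro i δ hδ
    have hS0 : S ≠ 0 := by rintro rfl; simp at hδ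
    have hq0 : (∑ j, (X j : MvPolynomial (Fin n) ℂ) ^ 2) ≠ 0 := by
      intro h; have := hqc i; rw [h] at this; simp at this
    have h1 := degreeOf_revPoly (N := N) P i
    rw [hS, degreeOf_mul_eq hq0 hS0] at h1
    have h2 : 2 ≤ degreeOf i (∑ j, (X j : MvPolynomial (Fin n) ℂ) ^ 2) := by
      have := monomial_le_degreeOf i (m := Finsupp.single i 2)
        (f := ∑ j, (X j : MvPolynomial (Fin n) ℂ) ^ 2) (by rw [mem_support_iff, hqc]; simp)
      simpa using this
    have h3 := monomial_le_degreeOf i (mem_support_iff.2 hδ)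
    omega
  classical
  let u : (Fin n →₀ ℕ) → ℂ := fun β =>
    if ∀ j, β j ≤ N then coeff (Finsupp.equivFunOnFinite.symm fun j => N - β j) S else 0
  let c : (Fin n →₀ ℕ) → ℂ := fun α => (∏ j, ((α j).factorial : ℂ)) * P.coeff α
  have hu : ∀ i β, β i < 2 → u β = 0 := by
    intro i β hβ
    simp only [u]
    split_ifs with h
    · by_contra hne
      have := hSdeg i _ hne
      simp only [Finsupp.equivFunOnFinite_symm_apply_apply] at this
      have := h i
      omega
    · rfl
  have hc : ∀ α, c α = ∑ j, u (α + Finsupp.single j 2) := by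
    intro α
    by_cases hα : ∀ j, α j ≤ N
    · simp only [c]
      rw [← coeff_revPoly hPhom α hα, hS, Finset.sum_mul, coeff_sum]
      apply Finset.sum_congr rfl
      intro i _
      rw [X_pow_eq_monomial, coeff_monomial_mul', one_mul]
      simp only [u]
      by_cases hi : α i + 2 ≤ N
      · rw [if_pos, if_pos]
        · congr 1
          ext j
          simp only [Finsupp.coe_tsub, Pi.sub_apply, Finsupp.equivFunOnFinite_symm_apply_apply,
            Finsupp.add_apply]
          omega
        · intro j
          by_cases hj : i = j
          · subst hj; simpa using hi
          · simpa [Finsupp.single_apply, hj] using hα j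
        · simp only [Finsupp.single_le_iff, Finsupp.equivFunOnFinite_symm_apply_apply]
          omega
      · rw [if_neg, if_neg]
        · intro h
          have := h i
          simp at this
          omega
        · simp only [Finsupp.single_le_iff, Finsupp.equivFunOnFinite_symm_apply_apply]
          omega
    · have h1 : c α = 0 := by
        simp only [c]
        have : α ∉ P.support := fun h => hα (le_of_hom hPhom h)
        rw [notMem_support_iff.1 this, mul_zero]
      rw [h1]
      symm
      apply Finset.sum_eq_zero
      intro i _
      simp only [u]
      rw [if_neg]
      intro h
      apply hα
      intro j
      have := h j
      rw [Finsupp.add_apply] at this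
      omega
  have hh : ∀ α, ∑ j, c (α + Finsupp.single j 2) = 0 := by
    intro α
    have h1 := congrArg (coeff α) hPharm
    rw [coeff_sum, coeff_zero] at h1
    have : ∑ j, c (α + Finsupp.single j 2) =
        (∏ j, ((α j).factorial : ℂ)) * ∑ j, coeff α (pderiv j (pderiv j P)) := by
      rw [Finset.mul_sum]
      apply Finset.sum_congr rfl
      intro i _
      simp only [c]
      rw [coeff_pderiv, coeff_pderiv, add_assoc, ← Finsupp.single_add]
      rw [← Finset.mul_prod_erase _ _ (Finset.mem_univ i),
        ← Finset.mul_prod_erase _ (fun j => ((α j).factorial : ℂ)) (Finset.mem_univ i)]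
      have : ∏ x ∈ Finset.univ.erase i, ((((α + Finsupp.single i 2 : Fin n →₀ ℕ)) x).factorial : ℂ)
          = ∏ x ∈ Finset.univ.erase i, ((α x).factorial : ℂ) := by
        apply Finset.prod_congr rfl
        intro x hx
        simp [Finset.ne_of_mem_erase hx]
      rw [this]
      simp [Nat.factorial_succ]
      ring
    rw [this, h1, mul_zero]
  have := comb_vanish ⟨0, by omega⟩ ⟨1, by omega⟩ (by simp) c u (hu _) (hu _) hc hh
  apply hP0
  ext α
  have h1 := this α
  simp only [c] at h1
  rcases mul_eq_zero.1 h1 with h | h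
  · rw [Finset.prod_eq_zero_iff] at h
    obtain ⟨j, _, hj⟩ := h
    exact absurd hj (by exact_mod_cast Nat.factorial_ne_zero _)
  · simpa using h

theorem exists_div {m : ℕ} (R : MvPolynomial (Fin (m+1)) ℂ) :
    ∃ A B : MvPolynomial (Fin m) ℂ,
      (∀ z y, z ^ 2 + ∑ j, y j ^ 2 = 0 →
        eval (Fin.cons z y : Fin (m+1) → ℂ) R = eval y A * z + eval y B) ∧
      (A = 0 → B = 0 → (∑ j, X j ^ 2) ∣ R) := by
  let q : Polynomial (MvPolynomial (Fin m) ℂ) := Polynomial.X ^ 2 + Polynomial.C (∑ j, X j ^ 2)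
  have hq : q.Monic := Polynomial.monic_X_pow_add_C _ (by norm_num)
  have hqe : finSuccEquiv ℂ m (∑ j, X j ^ 2) = q := by
    rw [Fin.sum_univ_succ]
    simp [q, finSuccEquiv_X_zero, finSuccEquiv_X_succ]
  have hdiv := Polynomial.modByMonic_add_div (finSuccEquiv ℂ m R) q
  have hdeg := Polynomial.degree_modByMonic_lt (finSuccEquiv ℂ m R) hq
  have hqd : q.degree = 2 := Polynomial.degree_X_pow_add_C (by norm_num) _
  rw [hqd] at hdeg
  obtain ⟨A, B, hAB⟩ : ∃ A B, finSuccEquiv ℂ m R %ₘ q = Polynomial.C A * Polynomial.X + Polynomial.C B :=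
    ⟨_, _, Polynomial.eq_X_add_C_of_degree_le_one (Order.le_of_lt_succ hdeg)⟩
  rw [hAB] at hdiv
  refine ⟨A, B, ?_, ?_⟩
  · intro z y hzy
    rw [eval_eq_eval_mv_eval', ← hdiv]
    have hq0 : Polynomial.eval z (Polynomial.map (eval y) q) = 0 := by
      rw [← hzy]
      simp only [q, Polynomial.map_add, Polynomial.map_pow, Polynomial.map_X, Polynomial.map_C,
        Polynomial.eval_add, Polynomial.eval_pow, Polynomial.eval_X, Polynomial.eval_C]
      simp only [map_sum, map_pow, eval_X]
    rw [Polynomial.map_add, Polynomial.map_mul, Polynomial.eval_add, Polynomial.eval_mul, hq0]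
    simp
  · rintro rfl rfl
    refine ⟨(finSuccEquiv ℂ m).symm (finSuccEquiv ℂ m R /ₘ q), ?_⟩
    apply (finSuccEquiv ℂ m).injective
    rw [map_mul, hqe, AlgEquiv.apply_symm_apply]
    simpa using hdiv.symm

theorem big_case {k : ℕ} (R : MvPolynomial (Fin (k+3)) ℂ) (O : Set (Fin (k+3) → ℂ)) (hO : IsOpen O)
    (ρ : Fin (k+3) → ℂ) (hρO : ρ ∈ O) (hρ : ∑ j, ρ j ^ 2 = 0) (hρ0 : ρ 0 ≠ 0)
    (hR : ∀ x ∈ O, ∑ j, x j ^ 2 = 0 → eval x R = 0) : (∑ j, X j ^ 2) ∣ R := by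
  obtain ⟨A, B, h1, h2⟩ := exists_div R
  let g : (Fin (k+2) → ℂ) → ℂ := fun y => ρ 0 * (-(∑ j, y j ^ 2) / ρ 0 ^ 2) ^ (((2:ℕ):ℂ)⁻¹)
  have hg : ∀ y, g y ^ 2 + ∑ j, y j ^ 2 = 0 := by
    intro y
    simp only [g]
    rw [mul_pow, Complex.cpow_nat_inv_pow _ (by norm_num)]
    field_simp
    ring
  let y0 : Fin (k+2) → ℂ := Fin.tail ρ
  have harg : -(∑ j, y0 j ^ 2) / ρ 0 ^ 2 = 1 := by
    rw [Fin.sum_univ_succ] at hρ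
    rw [div_eq_one_iff_eq (pow_ne_zero _ hρ0)]
    simp only [y0, Fin.tail]
    linear_combination -hρ
  have hg0 : g y0 = ρ 0 := by
    simp only [g]; rw [harg, Complex.one_cpow, mul_one]
  have hgc : ContinuousAt g y0 := by
    apply ContinuousAt.mul continuousAt_const
    apply ContinuousAt.cpow _ continuousAt_const
    · rw [harg]; exact Complex.one_mem_slitPlane
    · apply Continuous.continuousAt
      exact (continuous_finsetSum _ fun j _ => (continuous_apply j).pow 2).neg.div_const _
  have hφ : ContinuousAt (fun y => (Fin.cons (g y) y : Fin (k+3) → ℂ)) y0 := by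
    rw [continuousAt_pi]
    intro i
    refine Fin.cases ?_ (fun j => ?_) i
    · simpa using hgc
    · simpa using (continuous_apply j).continuousAt
  have hev : ∀ᶠ y in nhds y0, (Fin.cons (g y) y : Fin (k+3) → ℂ) ∈ O := by
    apply hφ
    apply hO.mem_nhds
    change (Fin.cons (g y0) y0 : Fin (k+3) → ℂ) ∈ O
    rw [hg0]
    simpa [y0] using hρO
  have hAB : ∀ᶠ y in nhds y0, eval y A * g y + eval y B = 0 := by
    filter_upwards [hev] with y hy
    rw [← h1 _ _ (hg y)]
    apply hR _ hy
    rw [Fin.sum_univ_succ]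
    simpa using hg y
  have hA : A = 0 := by
    apply not_square A B
    apply zero_of_eventually _ y0
    filter_upwards [hAB] with y hy
    simp
    linear_combination (eval y B - eval y A * g y) * hy + (eval y A)^2 * hg y
  apply h2 hA
  apply zero_of_eventually _ y0
  filter_upwards [hAB] with y hy
  simpa [hA] using hy

theorem line_zero (R : MvPolynomial (Fin 2) ℂ) (A B : MvPolynomial (Fin 1) ℂ) (s : ℂ) (hs : s ^ 2 = -1)
    (h1 : ∀ z y, z ^ 2 + ∑ j, y j ^ 2 = 0 →
        eval (Fin.cons z y : Fin 2 → ℂ) R = eval y A * z + eval y B)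
    (O : Set (Fin 2 → ℂ)) (hO : IsOpen O) (ρ : Fin 2 → ℂ) (hρO : ρ ∈ O)
    (hρ : ρ 0 = s * ρ 1) (hρ1 : ρ 1 ≠ 0)
    (hR : ∀ x ∈ O, x 0 = s * x 1 → x 1 ≠ 0 → eval x R = 0) : C s * A * X 0 + B = 0 := by
  apply zero_of_eventually _ (fun _ => ρ 1)
  have hc : Continuous (fun y : Fin 1 → ℂ => (Fin.cons (s * y 0) y : Fin 2 → ℂ)) := by
    apply continuous_pi
    intro i
    refine Fin.cases ?_ (fun j => ?_) i
    · simp; fun_prop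
    · simpa using continuous_apply j
  have hev : ∀ᶠ y in nhds (fun _ : Fin 1 => ρ 1), (Fin.cons (s * y 0) y : Fin 2 → ℂ) ∈ O := by
    apply hc.continuousAt
    apply hO.mem_nhds
    convert hρO using 1
    ext i
    fin_cases i
    · simp [hρ]
    · rfl
  have hev2 : ∀ᶠ y in nhds (fun _ : Fin 1 => ρ 1), y 0 ≠ 0 :=
    (continuous_apply (0 : Fin 1)).continuousAt.eventually_ne hρ1
  filter_upwards [hev, hev2] with y hy hy2
  have e1 := h1 (s * y 0) y (by simp [mul_pow, hs])
  have e2 := hR _ hy (by rfl) hy2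
  rw [e2] at e1
  simp
  linear_combination -e1

/-- The Laplace transform of a nonzero harmonic homogeneous polynomial cannot vanish
identically on an open subset of the characteristic variety `{ρ·ρ = 0}` when `n ≥ 3`;
for `n = 2` it cannot vanish identically on relatively open subsets of both lines
`ρ₁ = iρ₂` and `ρ₁ = -iρ₂`. -/
theorem laplace_transform_harmonic_nonvanishing
    (n N : ℕ) (hn : 2 ≤ n) (P : MvPolynomial (Fin n) ℂ)
    (hP0 : P ≠ 0) (hPhom : P.IsHomogeneous N)
    (hPharm : ∑ j : Fin n, pderiv j (pderiv j P) = 0) :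
    (3 ≤ n →
      ∀ W : Set (Fin n → ℂ), W.Nonempty →
        W ⊆ {ρ | (∑ j, ρ j ^ 2) = 0 ∧ ∀ j, ρ j ≠ 0} →
        (∃ O : Set (Fin n → ℂ), IsOpen O ∧ W = O ∩ {ρ | (∑ j, ρ j ^ 2) = 0}) →
        ¬ ∀ ρ ∈ W, eval (fun j => (ρ j)⁻¹) (assocPoly n P) = 0) ∧
    (n = 2 →
      ∀ W₁ W₂ : Set (Fin n → ℂ), W₁.Nonempty → W₂.Nonempty →
        (∃ O : Set (Fin n → ℂ), IsOpen O ∧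
          W₁ = O ∩ {ρ | ρ ⟨0, by omega⟩ = Complex.I * ρ ⟨1, by omega⟩ ∧
            ρ ⟨0, by omega⟩ * ρ ⟨1, by omega⟩ ≠ 0}) →
        (∃ O : Set (Fin n → ℂ), IsOpen O ∧
          W₂ = O ∩ {ρ | ρ ⟨0, by omega⟩ = -Complex.I * ρ ⟨1, by omega⟩ ∧
            ρ ⟨0, by omega⟩ * ρ ⟨1, by omega⟩ ≠ 0}) →
        ¬ ((∀ ρ ∈ W₁, eval (fun j => (ρ j)⁻¹) (assocPoly n P) = 0) ∧
           (∀ ρ ∈ W₂, eval (fun j => (ρ j)⁻¹) (assocPoly n P) = 0))) := by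
  constructor
  · intro h3 W hWne hWsub hWO hvan
    obtain ⟨k, rfl⟩ : ∃ k, n = k + 3 := ⟨n - 3, by omega⟩
    obtain ⟨O, hO, rfl⟩ := hWO
    obtain ⟨ρ, hρ⟩ := hWne
    apply not_dvd_rev hn P hP0 hPhom hPharm
    apply big_case _ O hO ρ hρ.1 hρ.2 ((hWsub hρ).2 0)
    intro x hx hx2
    exact eval_revPoly hPhom x (hWsub ⟨hx, hx2⟩).2 (hvan x ⟨hx, hx2⟩)
  · intro h2
    subst h2
    rintro W₁ W₂ ⟨ρ, hρ⟩ ⟨σ, hσ⟩ ⟨O₁, hO₁, rfl⟩ ⟨O₂, hO₂, rfl⟩ ⟨hv1, hv2⟩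
    obtain ⟨A, B, h1, h2⟩ := exists_div (revPoly 2 N P)
    have key : ∀ s : ℂ, s ^ 2 = -1 → ∀ x : Fin 2 → ℂ, x 0 = s * x 1 → x 1 ≠ 0 → ∀ j, x j ≠ 0 := by
      intro s hs x hx hx1 j
      fin_cases j
      · have : s ≠ 0 := by rintro rfl; norm_num at hs
        simpa [hx] using ⟨this, hx1⟩
      · exact hx1
    have hI : (-Complex.I) ^ 2 = -1 := by simp
    have e1 := line_zero _ A B Complex.I Complex.I_sq h1 O₁ hO₁ ρ hρ.1 hρ.2.1
      (right_ne_zero_of_mul hρ.2.2) (fun x hx hx0 hx1 => by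
        have hk := key _ Complex.I_sq x hx0 hx1
        exact eval_revPoly hPhom x hk (hv1 x ⟨hx, hx0, mul_ne_zero (hk _) (hk _)⟩))
    have e2 := line_zero _ A B (-Complex.I) hI h1 O₂ hO₂ σ hσ.1 hσ.2.1
      (right_ne_zero_of_mul hσ.2.2) (fun x hx hx0 hx1 => by
        have hk := key _ hI x hx0 hx1
        exact eval_revPoly hPhom x hk (hv2 x ⟨hx, hx0, mul_ne_zero (hk _) (hk _)⟩))
    rw [map_neg] at e2
    have hA : A = 0 := by
      have e3 : C (2 * Complex.I) * (A * X 0) = 0 := by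
        rw [map_mul, map_ofNat]
        linear_combination e1 - e2
      rcases mul_eq_zero.1 e3 with h | h
      · rw [C_eq_zero] at h
        simp at h
      · rcases mul_eq_zero.1 h with h | h
        · exact h
        · exact absurd h (X_ne_zero _)
    have hB : B = 0 := by simpa [hA] using e1
    exact not_dvd_rev hn P hP0 hPhom hPharm (h2 hA hB)
end

section
/- Let k ≥ 2 and let P : ℝⁿ → ℝ^k be smooth with: M = P⁻¹({0}) compact and nonempty; the derivative DP(m) : ℝⁿ → ℝ^k surjective at every m ∈ M; and liminf_{|ξ|→∞} |P(ξ)| > 0. Let (χ_ε)_{ε ∈ (0,1]} be a family of ε-mollifiers on ℝⁿ × ℝⁿ and let F : ℝ^k → ℂ be measurable with |F(z)| ≤ 1/|z| for all z ≠ 0. Then F∘P is locally integrable on ℝⁿ and there exist constants C > 0 and ε₀ ∈ (0,1] such that for all ε ∈ (0, ε₀): sup_{x ∈ ℝⁿ} |∫_{ℝⁿ} χ_ε(x,y) F(P(y)) dy| ≤ C/ε. -/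
open MeasureTheory
open scoped ENNReal NNReal

/-- A family of `ε`-mollifiers on `ℝⁿ × ℝⁿ`, indexed by `ε ∈ (0,1]`: measurable functions
with uniformly bounded `L¹` norms in `y`, satisfying the pointwise decay bounds
`|χ_ε(x,y)| ≤ (C_N/εⁿ)(ε/|x-y|)^N` and
`|∇_y χ_ε(x,y)| ≤ (C_N/ε^{n+1})(ε/|x-y|)^N` for every `N`. -/
structure IsMollifierFamily (n : ℕ) (χ : ℝ → (Fin n → ℝ) → (Fin n → ℝ) → ℂ) : Prop where
  measurable : ∀ ε ∈ Set.Ioc (0 : ℝ) 1, Measurable (Function.uncurry (χ ε))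
  l1_bound : ∃ C₀ : ℝ, ∀ ε ∈ Set.Ioc (0 : ℝ) 1, ∀ x,
    (∫⁻ y, (‖χ ε x y‖₊ : ℝ≥0∞)) ≤ ENNReal.ofReal C₀
  decay : ∀ N : ℕ, ∃ C : ℝ, ∀ ε ∈ Set.Ioc (0 : ℝ) 1, ∀ x y,
    ‖χ ε x y‖ * ‖x - y‖ ^ N ≤ C / ε ^ n * ε ^ N
  grad_decay : ∀ N : ℕ, ∃ C : ℝ, ∀ ε ∈ Set.Ioc (0 : ℝ) 1, ∀ x y,
    ‖fderiv ℝ (χ ε x) y‖ * ‖x - y‖ ^ N ≤ C / ε ^ (n + 1) * ε ^ N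


lemma lint_prod (n : ℕ) (f : Fin n → ℝ → ℝ≥0∞) (hf : ∀ i, Measurable (f i)) :
    ∫⁻ z : Fin n → ℝ, ∏ i, f i (z i) = ∏ i, ∫⁻ t, f i t := by
  induction n with
  | zero => simp [lintegral_unique, volume_pi]
  | succ n ih =>
    have h := ((volume_preserving_piFinSuccAbove (fun _ : Fin (n+1) => ℝ) 0).symm)
    rw [← h.lintegral_comp_emb (MeasurableEquiv.measurableEmbedding _)]
    rw [Fin.prod_univ_succ, ← ih (fun i => f i.succ) (fun i => hf _)]
    rw [← lintegral_prod_mul (hf 0).aemeasurable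
      (Finset.measurable_fun_prod _ fun i _ => (hf i.succ).comp (measurable_pi_apply i)).aemeasurable]
    refine lintegral_congr fun x => ?_
    rw [Fin.prod_univ_succ]
    rfl

lemma one_d_a (ε : ℝ) (hε : 0 < ε) (w : ℝ) :
    ∫⁻ t : ℝ, ENNReal.ofReal (1 + ((w - t) / ε) ^ 2)⁻¹ = ENNReal.ofReal (Real.pi * ε) := by
  have hi : Integrable (fun t : ℝ => (1 + ((w - t) / ε) ^ 2)⁻¹) :=
    (integrable_inv_one_add_sq.comp_div hε.ne').comp_sub_left w
  rw [← ofReal_integral_eq_lintegral_ofReal hi (Filter.Eventually.of_forall fun t => by positivity)]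
  congr 1
  rw [integral_sub_left_eq_self (fun t : ℝ => (1 + (t / ε) ^ 2)⁻¹) volume w,
    Measure.integral_comp_div (fun t : ℝ => (1 + t ^ 2)⁻¹) ε, integral_univ_inv_one_add_sq]
  rw [abs_of_pos hε, smul_eq_mul, mul_comm]

lemma one_d_c (ε : ℝ) (hε : 0 < ε) :
    ∫⁻ t in Set.Ioc 0 ε, ENNReal.ofReal (t ^ (-(1/2) : ℝ)) =
      ENNReal.ofReal (2 * ε ^ (1/2 : ℝ)) := by
  have hi : IntervalIntegrable (fun t : ℝ => t ^ (-(1/2) : ℝ)) volume 0 ε :=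
    intervalIntegral.intervalIntegrable_rpow' (by norm_num)
  rw [← ofReal_integral_eq_lintegral_ofReal
    ((intervalIntegrable_iff_integrableOn_Ioc_of_le hε.le).1 hi)]
  · rw [← intervalIntegral.integral_of_le hε.le, integral_rpow (by left; norm_num)]
    congr 1
    norm_num
    ring
  · filter_upwards [ae_restrict_mem measurableSet_Ioc] with t ht
    exact Real.rpow_nonneg ht.1.le _

lemma one_d_b (ε : ℝ) (hε : 0 < ε) (w : ℝ) :
    ∫⁻ t : ℝ, ENNReal.ofReal (1 + ((w - t) / ε) ^ 2)⁻¹ * (‖t‖ₑ ^ (1/2 : ℝ))⁻¹ ≤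
      ENNReal.ofReal ((Real.pi + 4) * ε * ε ^ (-(1/2) : ℝ)) := by
  let φ : ℝ → ℝ≥0∞ := (Set.Ioc 0 ε).indicator fun t => ENNReal.ofReal (t ^ (-(1/2) : ℝ))
  have hφm : Measurable φ := Measurable.indicator (by fun_prop) measurableSet_Ioc
  have hφ : ∫⁻ t, φ t = ENNReal.ofReal (2 * ε ^ (1/2 : ℝ)) := by
    rw [lintegral_indicator measurableSet_Ioc, one_d_c ε hε]
  have key : ∀ᵐ t : ℝ, ENNReal.ofReal (1 + ((w - t) / ε) ^ 2)⁻¹ * (‖t‖ₑ ^ (1/2 : ℝ))⁻¹ ≤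
      ENNReal.ofReal (1 + ((w - t) / ε) ^ 2)⁻¹ * ENNReal.ofReal (ε ^ (-(1/2) : ℝ)) +
        (φ t + φ (-t)) := by
    have : ∀ᵐ t : ℝ, t ≠ 0 := by simp [ae_iff]
    filter_upwards [this] with t ht
    have h1 : (‖t‖ₑ ^ (1/2 : ℝ))⁻¹ = ENNReal.ofReal (|t| ^ (-(1/2) : ℝ)) := by
      have ht' : 0 < |t| := abs_pos.2 ht
      rw [← ofReal_norm, Real.norm_eq_abs, ENNReal.ofReal_rpow_of_pos ht',
        ← ENNReal.ofReal_inv_of_pos (by positivity), Real.rpow_neg ht'.le]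
    rw [h1]
    have hle1 : ENNReal.ofReal (1 + ((w - t) / ε) ^ 2)⁻¹ ≤ 1 := by
      rw [← ENNReal.ofReal_one]
      apply ENNReal.ofReal_le_ofReal
      apply inv_le_one_of_one_le₀
      nlinarith [sq_nonneg ((w - t) / ε)]
    by_cases hc : |t| ≤ ε
    · refine le_trans ?_ le_add_self
      refine (mul_le_mul_left hle1 _).trans ?_
      rw [one_mul]
      rcases lt_or_gt_of_ne ht with h | h
      · refine le_trans ?_ le_add_self
        rw [abs_of_neg h] at hc ⊢
        simp only [φ]
        rw [Set.indicator_of_mem (show -t ∈ Set.Ioc 0 ε from ⟨by linarith, hc⟩)]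
      · refine le_trans ?_ le_self_add
        rw [abs_of_pos h] at hc ⊢
        simp only [φ]
        rw [Set.indicator_of_mem (show t ∈ Set.Ioc 0 ε from ⟨by linarith, hc⟩)]
    · refine le_trans ?_ le_self_add
      apply mul_le_mul_right
      apply ENNReal.ofReal_le_ofReal
      exact Real.rpow_le_rpow_of_nonpos hε (not_le.1 hc).le (by norm_num)
  refine (lintegral_mono_ae key).trans ?_
  rw [lintegral_add_left (by fun_prop), lintegral_mul_const _ (by fun_prop),
    lintegral_add_left hφm, lintegral_neg_eq_self φ, hφ, one_d_a ε hε, ← ENNReal.ofReal_mul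
    (by positivity), ← ENNReal.ofReal_add (by positivity) (by positivity), ← ENNReal.ofReal_add (by positivity) (by positivity)]
  apply ENNReal.ofReal_le_ofReal
  have : ε ^ (1/2:ℝ) = ε * ε ^ (-(1/2):ℝ) := by
    rw [← Real.rpow_one_add' hε.le (by norm_num)]; norm_num
  rw [this]
  apply le_of_eq; ring

/-- product bound -/
lemma prod_bound (n : ℕ) (i j : Fin n) (hij : i ≠ j) (ε : ℝ) (hε : 0 < ε) (w : Fin n → ℝ) :
    ∫⁻ z : Fin n → ℝ, ENNReal.ofReal ((1 + (‖w - z‖ / ε) ^ 2) ^ n)⁻¹ *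
      ((‖z i‖ₑ ^ (1/2 : ℝ))⁻¹ * (‖z j‖ₑ ^ (1/2 : ℝ))⁻¹) ≤
      ENNReal.ofReal ((Real.pi + 4) ^ n * ε ^ n / ε) := by
  let f : Fin n → ℝ → ℝ≥0∞ := fun l t => ENNReal.ofReal (1 + ((w l - t) / ε) ^ 2)⁻¹ *
    ((if l = i then (‖t‖ₑ ^ (1/2 : ℝ))⁻¹ else 1) * (if l = j then (‖t‖ₑ ^ (1/2 : ℝ))⁻¹ else 1))
  have hf : ∀ l, Measurable (f l) := by
    intro l
    simp only [f]
    split_ifs <;> fun_prop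
  have h1 : ∀ z : Fin n → ℝ, ENNReal.ofReal ((1 + (‖w - z‖ / ε) ^ 2) ^ n)⁻¹ *
      ((‖z i‖ₑ ^ (1/2 : ℝ))⁻¹ * (‖z j‖ₑ ^ (1/2 : ℝ))⁻¹) ≤ ∏ l, f l (z l) := by
    intro z
    simp only [f]
    rw [Finset.prod_mul_distrib, Finset.prod_mul_distrib]
    simp only [Finset.prod_ite_eq', Finset.mem_univ, if_true]
    gcongr
    rw [← ENNReal.ofReal_prod_of_nonneg (fun l _ => by positivity)]
    apply ENNReal.ofReal_le_ofReal
    rw [Finset.prod_inv_distrib]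
    apply inv_anti₀ (Finset.prod_pos fun l _ => by positivity)
    calc ∏ l, (1 + ((w l - z l) / ε) ^ 2) ≤ ∏ l : Fin n, (1 + (‖w - z‖ / ε) ^ 2) := by
          apply Finset.prod_le_prod (fun l _ => by positivity)
          intro l _
          have := norm_le_pi_norm (w - z) l
          rw [← sq_abs ((w l - z l) / ε), abs_div, abs_of_pos hε]
          gcongr
          simpa using this
      _ = _ := by simp
  refine (lintegral_mono h1).trans ?_
  rw [lint_prod n f hf]
  have h2 : ∀ l, ∫⁻ t, f l t ≤ ENNReal.ofReal ((Real.pi + 4) * ε *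
      ((if l = i then ε ^ (-(1/2) : ℝ) else 1) * (if l = j then ε ^ (-(1/2) : ℝ) else 1))) := by
    intro l
    simp only [f]
    by_cases hi : l = i
    · have hj : l ≠ j := fun h => hij (hi.symm.trans h)
      simp only [hi, hij, if_true, if_false, mul_one]
      exact one_d_b ε hε (w i)
    · by_cases hj : l = j
      · simp only [hj, hij.symm, if_true, if_false, one_mul]
        exact one_d_b ε hε (w j)
      · simp only [hi, hj, if_false, mul_one]
        rw [one_d_a ε hε]
        apply ENNReal.ofReal_le_ofReal
        nlinarith
  refine (Finset.prod_le_prod' fun l _ => h2 l).trans ?_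
  have h3 : ∀ l : Fin n, 0 ≤ (Real.pi + 4) * ε *
      ((if l = i then ε ^ (-(1/2) : ℝ) else 1) * (if l = j then ε ^ (-(1/2) : ℝ) else 1)) := by
    intro l
    split_ifs <;> positivity
  rw [← ENNReal.ofReal_prod_of_nonneg (fun l _ => h3 l)]
  apply ENNReal.ofReal_le_ofReal
  rw [Finset.prod_mul_distrib, Finset.prod_mul_distrib, Finset.prod_mul_distrib]
  simp only [Finset.prod_ite_eq', Finset.mem_univ, if_true, Finset.prod_const, Finset.card_univ,
    Fintype.card_fin]
  rw [← Real.rpow_add hε]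
  norm_num [Real.rpow_neg_one, div_eq_mul_inv]

lemma lin_complete (n k : ℕ) (A : (Fin n → ℝ) →L[ℝ] (Fin k → ℝ)) (hA : Function.Surjective A)
    (a b : Fin k) (hab : a ≠ b) :
    ∃ (i j : Fin n) (T : (Fin n → ℝ) ≃L[ℝ] (Fin n → ℝ)), i ≠ j ∧
      ∀ y, T y i = A y a ∧ T y j = A y b := by
  let f : Fin k → Module.Dual ℝ (Fin n → ℝ) := fun c => (LinearMap.proj c).comp A.toLinearMap
  have hf : LinearIndependent ℝ f := by
    rw [Fintype.linearIndependent_iff]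
    intro g hg c
    obtain ⟨v, hv⟩ := hA (Pi.single c 1)
    have := congrArg (fun φ : Module.Dual ℝ (Fin n → ℝ) => φ v) hg
    simpa [f, hv, Pi.single_apply] using this
  have hs := hf.linearIndepOn_id
  let B := Module.Basis.extend hs
  have : Finite (hs.extend (Set.subset_univ _)) := Module.Finite.finite_basis B
  have hcard : Nat.card (hs.extend (Set.subset_univ _)) = n := by
    rw [← Module.finrank_eq_nat_card_basis B, Subspace.dual_finrank_eq]; simp
  let e : (hs.extend (Set.subset_univ _)) ≃ Fin n := Finite.equivFinOfCardEq hcard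
  have hmem : ∀ c, f c ∈ hs.extend (Set.subset_univ _) := fun c =>
    hs.subset_extend _ (Set.mem_range_self c)
  let T0 : (Fin n → ℝ) →ₗ[ℝ] (Fin n → ℝ) := LinearMap.pi fun l => B (e.symm l)
  have hT0 : Function.Injective T0 := by
    rw [← LinearMap.ker_eq_bot, LinearMap.ker_eq_bot']
    intro y hy
    have h1 : ∀ l, B l y = 0 := by
      intro l
      have := congrFun hy (e l)
      simpa [T0] using this
    have h2 : Module.Dual.eval ℝ (Fin n → ℝ) y = 0 := B.ext (by simpa using h1)
    exact (Module.forall_dual_apply_eq_zero_iff ℝ y).1 fun φ => LinearMap.congr_fun h2 φ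
  have hBc : ∀ c, B ⟨f c, hmem c⟩ = f c := fun c => Module.Basis.extend_apply_self hs _
  refine ⟨e ⟨f a, hmem a⟩, e ⟨f b, hmem b⟩,
    (LinearEquiv.ofInjectiveEndo T0 hT0).toContinuousLinearEquiv, ?_, ?_⟩
  · intro h
    have := e.injective h
    exact hab (hf.injective (congrArg Subtype.val this))
  · intro y
    constructor
    · have : T0 y (e ⟨f a, hmem a⟩) = A y a := by
        simp only [T0, LinearMap.pi_apply, Equiv.symm_apply_apply, hBc]; rfl
      simpa using this
    · have : T0 y (e ⟨f b, hmem b⟩) = A y b := by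
        simp only [T0, LinearMap.pi_apply, Equiv.symm_apply_apply, hBc]; rfl
      simpa using this

lemma local_bound (n k : ℕ) (hk : 2 ≤ k)
    (P : (Fin n → ℝ) → (Fin k → ℝ)) (hP : ContDiff ℝ (⊤ : ℕ∞) P)
    (m : Fin n → ℝ) (hsurj : Function.Surjective (fderiv ℝ P m)) :
    ∃ U : Set (Fin n → ℝ), IsOpen U ∧ m ∈ U ∧ ∃ C : ℝ, 0 ≤ C ∧ ∀ ε > 0, ∀ x : Fin n → ℝ,
      ∫⁻ y in U, ENNReal.ofReal ((1 + (‖x - y‖ / ε) ^ 2) ^ n)⁻¹ * ‖P y‖ₑ⁻¹ ≤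
        ENNReal.ofReal (C * ε ^ n / ε) := by
  let a : Fin k := ⟨0, by omega⟩
  let b : Fin k := ⟨1, by omega⟩
  obtain ⟨i, j, T, hij, hT⟩ := lin_complete n k (fderiv ℝ P m) hsurj a b (by simp [a, b])
  let Φ : (Fin n → ℝ) → (Fin n → ℝ) := fun y l =>
    if l = i then P y a else if l = j then P y b else T y l
  have hΦi : ∀ y, Φ y i = P y a := fun y => by simp [Φ]
  have hΦj : ∀ y, Φ y j = P y b := fun y => by simp [Φ, hij.symm]
  have hPc : ∀ c, ContDiff ℝ 1 (fun y => P y c) := fun c =>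
    contDiff_pi.1 (hP.of_le (by exact_mod_cast le_top)) c
  have hΦ : ContDiff ℝ 1 Φ := by
    rw [contDiff_pi]
    intro l
    simp only [Φ]
    split_ifs
    · exact hPc a
    · exact hPc b
    · exact contDiff_pi.1 T.contDiff l
  have hPs : HasStrictFDerivAt P (fderiv ℝ P m) m :=
    hP.contDiffAt.hasStrictFDerivAt (by simp)
  have hΦs : HasStrictFDerivAt Φ (T : (Fin n → ℝ) →L[ℝ] (Fin n → ℝ)) m := by
    rw [hasStrictFDerivAt_pi']
    intro l
    simp only [Φ]
    split_ifs with h1 h2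
    · subst h1
      have := hasStrictFDerivAt_pi'.1 hPs a
      convert this using 1
      ext y
      simp [(hT _).1]
    · subst h2
      have := hasStrictFDerivAt_pi'.1 hPs b
      convert this using 1
      ext y
      simp [(hT _).2]
    · exact hasStrictFDerivAt_pi'.1 T.hasStrictFDerivAt l
  -- injectivity near m
  let e := hΦs.toOpenPartialHomeomorph Φ
  have hsrc : e.source ∈ nhds m :=
    e.open_source.mem_nhds hΦs.mem_toOpenPartialHomeomorph_source
  obtain ⟨L, t, ht, hL⟩ := hΦs.exists_lipschitzOnWith
  have hdetT : (fderiv ℝ Φ m).det ≠ 0 := by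
    rw [hΦs.hasFDerivAt.fderiv]
    exact (LinearEquiv.isUnit_det' T.toLinearEquiv).ne_zero
  have hdetc : Continuous fun y => |(fderiv ℝ Φ y).det| :=
    (ContinuousLinearMap.continuous_det.comp (hΦ.continuous_fderiv (by simp))).abs
  set c := |(fderiv ℝ Φ m).det| / 2 with hc
  have hcpos : 0 < c := by positivity
  have hdn : {y | c < |(fderiv ℝ Φ y).det|} ∈ nhds m :=
    (isOpen_lt continuous_const hdetc).mem_nhds (by
      change c < |(fderiv ℝ Φ m).det|
      have : 0 < |(fderiv ℝ Φ m).det| := abs_pos.2 hdetT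
      linarith)
  obtain ⟨U, hUsub, hUo, hmU⟩ := mem_nhds_iff.1 (Filter.inter_mem (Filter.inter_mem hsrc ht) hdn)
  have hinj : Set.InjOn Φ U := by
    have := e.injOn
    exact this.mono fun y hy => (hUsub hy).1.1
  obtain ⟨Ψ, hΨ, hEq⟩ := (hL.mono (fun y (hy : y ∈ U) => (hUsub hy).1.2)).extend_pi
  set K : ℝ := L + 1
  have hK : 0 < K := by positivity
  refine ⟨U, hUo, hmU, c⁻¹ * ((Real.pi + 4) ^ n * K ^ n / K), by positivity, ?_⟩
  intro ε hε x
  set w := Ψ x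
  let G : (Fin n → ℝ) → ℝ≥0∞ := fun z => ENNReal.ofReal ((1 + (‖w - z‖ / (K * ε)) ^ 2) ^ n)⁻¹ *
      ((‖z i‖ₑ ^ (1/2 : ℝ))⁻¹ * (‖z j‖ₑ ^ (1/2 : ℝ))⁻¹)
  have hG : ∫⁻ z, G z ≤ ENNReal.ofReal ((Real.pi + 4) ^ n * (K * ε) ^ n / (K * ε)) :=
    prod_bound n i j hij (K * ε) (by positivity) w
  have hpt : ∀ y ∈ U, ENNReal.ofReal ((1 + (‖x - y‖ / ε) ^ 2) ^ n)⁻¹ * ‖P y‖ₑ⁻¹ ≤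
      ENNReal.ofReal c⁻¹ * (ENNReal.ofReal |(fderiv ℝ Φ y).det| * G (Φ y)) := by
    intro y hy
    have h1 : ENNReal.ofReal ((1 + (‖x - y‖ / ε) ^ 2) ^ n)⁻¹ * ‖P y‖ₑ⁻¹ ≤ G (Φ y) := by
      simp only [G]
      refine mul_le_mul' ?_ ?_
      · apply ENNReal.ofReal_le_ofReal
        apply inv_anti₀ (by positivity)
        have h2 : ‖w - Φ y‖ ≤ K * ‖x - y‖ := by
          have := hΨ.dist_le_mul x y
          rw [hEq hy, ← dist_eq_norm, ← dist_eq_norm]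
          refine this.trans ?_
          gcongr
          simp [K]
        have h3 : ‖w - Φ y‖ / (K * ε) ≤ ‖x - y‖ / ε := by
          rw [div_le_div_iff₀ (by positivity) hε]
          nlinarith
        gcongr
      · rw [hΦi, hΦj, ← ENNReal.mul_inv (Or.inr (by simp)) (Or.inl (by simp))]
        rw [ENNReal.inv_le_inv]
        have hle : ∀ d, ‖P y d‖ₑ ≤ ‖P y‖ₑ := fun d => by
          rw [enorm_le_iff_norm_le]; exact norm_le_pi_norm (P y) d
        calc ‖P y a‖ₑ ^ (1/2:ℝ) * ‖P y b‖ₑ ^ (1/2:ℝ)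
            ≤ ‖P y‖ₑ ^ (1/2:ℝ) * ‖P y‖ₑ ^ (1/2:ℝ) := by
              gcongr
              · exact hle a
              · exact hle b
          _ = ‖P y‖ₑ := by
              rw [← ENNReal.rpow_add_of_nonneg _ _ (by norm_num) (by norm_num)]
              norm_num
    refine h1.trans ?_
    rw [← mul_assoc, ← ENNReal.ofReal_mul (by positivity)]
    refine le_mul_of_one_le_left' ?_
    rw [← ENNReal.ofReal_one]
    apply ENNReal.ofReal_le_ofReal
    have : c < |(fderiv ℝ Φ y).det| := (hUsub hy).2
    rw [inv_mul_eq_div, le_div_iff₀ hcpos]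
    linarith
  calc _ ≤ ∫⁻ y in U, ENNReal.ofReal c⁻¹ * (ENNReal.ofReal |(fderiv ℝ Φ y).det| * G (Φ y)) :=
        setLIntegral_mono' hUo.measurableSet hpt
    _ = ENNReal.ofReal c⁻¹ * ∫⁻ y in U, (ENNReal.ofReal |(fderiv ℝ Φ y).det| * G (Φ y)) :=
        lintegral_const_mul' _ _ (by simp)
    _ = ENNReal.ofReal c⁻¹ * ∫⁻ z in Φ '' U, G z := by
        rw [lintegral_image_eq_lintegral_abs_det_fderiv_mul volume hUo.measurableSet
          (fun y _ => ((hΦ.differentiable (by simp)) y).hasFDerivAt.hasFDerivWithinAt) hinj]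
    _ ≤ ENNReal.ofReal c⁻¹ * ENNReal.ofReal ((Real.pi + 4) ^ n * (K * ε) ^ n / (K * ε)) := by
        gcongr
        exact (setLIntegral_le_lintegral _ _).trans hG
    _ = _ := by
        rw [← ENNReal.ofReal_mul (by positivity)]
        congr 1
        rw [mul_pow]
        field_simp

/-- global bound -/
lemma global_bound (n k : ℕ) (hk : 2 ≤ k)
    (P : (Fin n → ℝ) → (Fin k → ℝ)) (hP : ContDiff ℝ (⊤ : ℕ∞) P)
    (hMc : IsCompact (P ⁻¹' {0}))
    (hsurj : ∀ m ∈ P ⁻¹' {0}, Function.Surjective (fderiv ℝ P m)) :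
    ∃ U : Set (Fin n → ℝ), IsOpen U ∧ P ⁻¹' {0} ⊆ U ∧ ∃ C : ℝ, 0 ≤ C ∧
      ∀ ε > 0, ∀ x : Fin n → ℝ,
      ∫⁻ y in U, ENNReal.ofReal ((1 + (‖x - y‖ / ε) ^ 2) ^ n)⁻¹ * ‖P y‖ₑ⁻¹ ≤
        ENNReal.ofReal (C * ε ^ n / ε) := by
  have key : ∃ V : Set (Fin n → ℝ), P ⁻¹' {0} ⊆ V ∧ ∃ U, V ⊆ U ∧ IsOpen U ∧ ∃ C : ℝ, 0 ≤ C ∧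
      ∀ ε > 0, ∀ x : Fin n → ℝ,
      ∫⁻ y in U, ENNReal.ofReal ((1 + (‖x - y‖ / ε) ^ 2) ^ n)⁻¹ * ‖P y‖ₑ⁻¹ ≤
        ENNReal.ofReal (C * ε ^ n / ε) := by
    refine ⟨_, subset_rfl, ?_⟩
    refine hMc.induction_on (p := fun V => ∃ U, V ⊆ U ∧ IsOpen U ∧ ∃ C : ℝ, 0 ≤ C ∧
      ∀ ε > 0, ∀ x : Fin n → ℝ,
      ∫⁻ y in U, ENNReal.ofReal ((1 + (‖x - y‖ / ε) ^ 2) ^ n)⁻¹ * ‖P y‖ₑ⁻¹ ≤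
        ENNReal.ofReal (C * ε ^ n / ε)) ?_ ?_ ?_ ?_
    · exact ⟨∅, subset_rfl, isOpen_empty, 0, le_rfl, by simp⟩
    · rintro s t hst ⟨U, hU, h⟩
      exact ⟨U, hst.trans hU, h⟩
    · rintro s t ⟨U, hU, hUo, C, hC, h⟩ ⟨U', hU', hUo', C', hC', h'⟩
      refine ⟨U ∪ U', Set.union_subset_union hU hU', hUo.union hUo', C + C', by positivity, ?_⟩
      intro ε hε x
      refine (lintegral_union_le _ _ _).trans ?_
      refine (add_le_add (h ε hε x) (h' ε hε x)).trans ?_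
      rw [← ENNReal.ofReal_add (by positivity) (by positivity)]
      apply le_of_eq
      congr 1; ring
    · intro m hm
      obtain ⟨U, hUo, hmU, h⟩ := local_bound n k hk P hP m (hsurj m hm)
      exact ⟨U, mem_nhdsWithin_of_mem_nhds (hUo.mem_nhds hmU), U, subset_rfl, hUo, h⟩
  obtain ⟨V, hV, U, hVU, hUo, h⟩ := key
  exact ⟨U, hUo, hV.trans hVU, h⟩

theorem mollifier_core
    (n k : ℕ) (hk : 2 ≤ k)
    (P : (Fin n → ℝ) → (Fin k → ℝ)) (hP : ContDiff ℝ (⊤ : ℕ∞) P)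
    (hMc : IsCompact (P ⁻¹' {0}))
    (hsurj : ∀ m ∈ P ⁻¹' {0}, Function.Surjective (fderiv ℝ P m))
    (hinf : ∃ B > (0 : ℝ), ∃ R : ℝ, ∀ ξ : Fin n → ℝ, R ≤ ‖ξ‖ → B ≤ ‖P ξ‖)
    (F : (Fin k → ℝ) → ℂ)
    (hFb : ∀ z : Fin k → ℝ, z ≠ 0 → ‖F z‖ ≤ 1 / ‖z‖) :
    ∃ C D : ℝ, 0 ≤ C ∧ 0 ≤ D ∧ ∀ ε > 0, ∀ x : Fin n → ℝ, ∀ g : (Fin n → ℝ) → ℝ≥0∞, ∀ c : ℝ, 0 ≤ c →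
      (∀ y, g y ≤ ENNReal.ofReal c * ENNReal.ofReal ((1 + (‖x - y‖ / ε) ^ 2) ^ n)⁻¹) →
      ∫⁻ y, g y * ‖F (P y)‖ₑ ≤
        ENNReal.ofReal (c * (C * ε ^ n / ε)) + (∫⁻ y, g y) * ENNReal.ofReal D := by
  obtain ⟨U, hUo, hMU, C, hC, hU⟩ := global_bound n k hk P hP hMc hsurj
  have hF' : ∀ z, ‖F z‖ₑ ≤ ‖z‖ₑ⁻¹ := by
    intro z
    by_cases hz : z = 0
    · simp [hz]
    · have := hFb z hz
      rw [← ofReal_norm, ← ofReal_norm, ← ENNReal.ofReal_inv_of_pos (norm_pos_iff.2 hz)]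
      apply ENNReal.ofReal_le_ofReal
      simpa using this
  have hδ : ∃ δ > 0, ∀ y ∉ U, δ ≤ ‖P y‖ := by
    obtain ⟨B, hB, R, hR⟩ := hinf
    have hcomp : IsCompact (Metric.closedBall (0 : Fin n → ℝ) R \ U) :=
      (isCompact_closedBall _ _).diff hUo
    rcases (Metric.closedBall (0 : Fin n → ℝ) R \ U).eq_empty_or_nonempty with he | hne
    · refine ⟨B, hB, fun y hy => hR y ?_⟩
      by_contra hlt
      have : y ∈ Metric.closedBall (0 : Fin n → ℝ) R \ U := ⟨by simp; linarith, hy⟩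
      rw [he] at this
      exact this
    · obtain ⟨y0, hy0, hmin⟩ := hcomp.exists_isMinOn hne hP.continuous.norm.continuousOn
      have hp : 0 < ‖P y0‖ := norm_pos_iff.2 fun h => hy0.2 (hMU h)
      refine ⟨min B ‖P y0‖, lt_min hB hp, fun y hy => ?_⟩
      by_cases hyR : R ≤ ‖y‖
      · exact (min_le_left _ _).trans (hR y hyR)
      · exact (min_le_right _ _).trans (hmin ⟨by simp; linarith, hy⟩)
  obtain ⟨δ, hδ, hout⟩ := hδ
  refine ⟨C, δ⁻¹, hC, by positivity, ?_⟩
  intro ε hε x g c hc hg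
  rw [← lintegral_add_compl _ hUo.measurableSet]
  refine add_le_add ?_ ?_
  · calc ∫⁻ y in U, g y * ‖F (P y)‖ₑ ≤ ∫⁻ y in U, ENNReal.ofReal c *
          (ENNReal.ofReal ((1 + (‖x - y‖ / ε) ^ 2) ^ n)⁻¹ * ‖P y‖ₑ⁻¹) := by
          apply lintegral_mono
          intro y
          dsimp only
          rw [← mul_assoc]
          exact mul_le_mul' (hg y) (hF' _)
      _ = ENNReal.ofReal c * ∫⁻ y in U,
          (ENNReal.ofReal ((1 + (‖x - y‖ / ε) ^ 2) ^ n)⁻¹ * ‖P y‖ₑ⁻¹) :=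
          lintegral_const_mul' _ _ (by simp)
      _ ≤ ENNReal.ofReal c * ENNReal.ofReal (C * ε ^ n / ε) := by gcongr; exact hU ε hε x
      _ = _ := by rw [← ENNReal.ofReal_mul hc]
  · calc ∫⁻ y in Uᶜ, g y * ‖F (P y)‖ₑ ≤ ∫⁻ y in Uᶜ, g y * ENNReal.ofReal δ⁻¹ := by
          apply setLIntegral_mono' hUo.measurableSet.compl
          intro y hy
          gcongr
          refine (hF' _).trans ?_
          rw [← ofReal_norm, ENNReal.ofReal_inv_of_pos hδ, ENNReal.inv_le_inv]
          exact ENNReal.ofReal_le_ofReal (hout y hy)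
      _ ≤ ∫⁻ y, g y * ENNReal.ofReal δ⁻¹ := setLIntegral_le_lintegral _ _
      _ = _ := lintegral_mul_const' _ _ (by simp)

/-- Let `P : ℝⁿ → ℝᵏ` (`k ≥ 2`) be smooth with compact nonempty regular zero set `M` and
`liminf_{|ξ|→∞} |P(ξ)| > 0`, and let `|F(z)| ≤ 1/|z|`.  Then `F ∘ P` is locally integrable
and `sup_x |∫ χ_ε(x,y) F(P(y)) dy| ≤ C/ε` for all sufficiently small `ε`. -/
theorem mollifier_convolution_reciprocal_bound
    (n k : ℕ) (hk : 2 ≤ k)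
    (P : (Fin n → ℝ) → (Fin k → ℝ)) (hP : ContDiff ℝ (⊤ : ℕ∞) P)
    (hMc : IsCompact (P ⁻¹' {0})) (hMne : (P ⁻¹' {0}).Nonempty)
    (hsurj : ∀ m ∈ P ⁻¹' {0}, Function.Surjective (fderiv ℝ P m))
    (hinf : ∃ B > (0 : ℝ), ∃ R : ℝ, ∀ ξ : Fin n → ℝ, R ≤ ‖ξ‖ → B ≤ ‖P ξ‖)
    (χ : ℝ → (Fin n → ℝ) → (Fin n → ℝ) → ℂ) (hχ : IsMollifierFamily n χ)
    (F : (Fin k → ℝ) → ℂ) (hF : Measurable F)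
    (hFb : ∀ z : Fin k → ℝ, z ≠ 0 → ‖F z‖ ≤ 1 / ‖z‖) :
    LocallyIntegrable (fun y => F (P y)) ∧
    ∃ C > (0 : ℝ), ∃ ε₀ ∈ Set.Ioc (0 : ℝ) 1, ∀ ε : ℝ, 0 < ε → ε < ε₀ →
      ∀ x : Fin n → ℝ,
        Integrable (fun y => χ ε x y * F (P y)) ∧
        ‖∫ y, χ ε x y * F (P y)‖ ≤ C / ε := by
  obtain ⟨C, D, hC, hD, hcore⟩ := mollifier_core n k hk P hP hMc hsurj hinf F hFb
  have hFP : Measurable fun y => F (P y) := hF.comp hP.continuous.measurable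
  constructor
  · rw [locallyIntegrable_iff]
    intro S hS
    obtain ⟨R, hR⟩ := hS.isBounded.subset_closedBall 0
    refine ⟨hFP.aestronglyMeasurable, ?_⟩
    have h := hcore 1 one_pos 0 (S.indicator 1) ((1 + R ^ 2) ^ n) (by positivity) (by
      intro y
      by_cases hy : y ∈ S
      · rw [Set.indicator_of_mem hy, ← ENNReal.ofReal_mul (by positivity), Pi.one_apply,
          ← ENNReal.ofReal_one]
        apply ENNReal.ofReal_le_ofReal
        have hyR : ‖y‖ ≤ R := by simpa using hR hy
        rw [← div_eq_mul_inv, one_le_div (by positivity), zero_sub, norm_neg, div_one]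
        gcongr
      · rw [Set.indicator_of_notMem hy]
        exact zero_le)
    have hfin : ∫⁻ y, S.indicator (1 : (Fin n → ℝ) → ℝ≥0∞) y < ⊤ := by
      rw [lintegral_indicator_one hS.measurableSet]
      exact hS.measure_lt_top
    rw [hasFiniteIntegral_iff_enorm, ← lintegral_indicator hS.measurableSet]
    refine lt_of_le_of_lt (le_of_eq ?_) (h.trans_lt
      (ENNReal.add_lt_top.2 ⟨ENNReal.ofReal_lt_top, ENNReal.mul_lt_top hfin ENNReal.ofReal_lt_top⟩))
    refine lintegral_congr fun y => ?_
    by_cases hy : y ∈ S <;> simp [hy]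
  · obtain ⟨C₀, h0⟩ := hχ.l1_bound
    obtain ⟨C₁, h1⟩ := hχ.decay 0
    obtain ⟨C₂, h2⟩ := hχ.decay (2 * n)
    set E : ℝ := 2 ^ n * (|C₁| + |C₂|) with hE
    have hE0 : 0 ≤ E := by positivity
    refine ⟨E * C + |C₀| * D + 1, by positivity, 1, by simp, ?_⟩
    intro ε hε hε1 x
    have hmem : ε ∈ Set.Ioc (0 : ℝ) 1 := ⟨hε, hε1.le⟩
    have hb : ∀ y, ‖χ ε x y‖ₑ ≤ ENNReal.ofReal (E / ε ^ n) *
        ENNReal.ofReal ((1 + (‖x - y‖ / ε) ^ 2) ^ n)⁻¹ := by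
      intro y
      rw [← ENNReal.ofReal_mul (by positivity), ← ofReal_norm]
      apply ENNReal.ofReal_le_ofReal
      rw [← div_eq_mul_inv, le_div_iff₀ (by positivity)]
      have a1 : ‖χ ε x y‖ ≤ |C₁| / ε ^ n := by
        have := h1 ε hmem x y
        simp only [pow_zero, mul_one] at this
        refine this.trans ?_
        gcongr
        exact le_abs_self _
      have a2 : ‖χ ε x y‖ * (‖x - y‖ / ε) ^ (2 * n) ≤ |C₂| / ε ^ n := by
        have := h2 ε hmem x y
        rw [div_pow, ← mul_div_assoc, div_le_iff₀ (by positivity)]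
        refine this.trans ?_
        gcongr
        exact le_abs_self _
      have a3 : (1 + (‖x - y‖ / ε) ^ 2) ^ n ≤ 2 ^ n * (1 + (‖x - y‖ / ε) ^ (2 * n)) := by
        refine (add_pow_le zero_le_one (sq_nonneg _) n).trans ?_
        rw [one_pow, ← pow_mul]
        gcongr
        · norm_num
        · omega
      calc ‖χ ε x y‖ * (1 + (‖x - y‖ / ε) ^ 2) ^ n
          ≤ ‖χ ε x y‖ * (2 ^ n * (1 + (‖x - y‖ / ε) ^ (2 * n))) := by gcongr
        _ = 2 ^ n * (‖χ ε x y‖ + ‖χ ε x y‖ * (‖x - y‖ / ε) ^ (2 * n)) := by ring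
        _ ≤ 2 ^ n * (|C₁| / ε ^ n + |C₂| / ε ^ n) := by gcongr
        _ = E / ε ^ n := by rw [hE]; ring
    have hL1 : ∫⁻ y, ‖χ ε x y‖ₑ ≤ ENNReal.ofReal |C₀| :=
      (h0 ε hmem x).trans (ENNReal.ofReal_le_ofReal (le_abs_self _))
    have hmain : ∫⁻ y, ‖χ ε x y * F (P y)‖ₑ ≤
        ENNReal.ofReal ((E * C + |C₀| * D + 1) / ε) := by
      calc ∫⁻ y, ‖χ ε x y * F (P y)‖ₑ = ∫⁻ y, ‖χ ε x y‖ₑ * ‖F (P y)‖ₑ := by simp only [enorm_mul]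
        _ ≤ _ := hcore ε hε x (fun y => ‖χ ε x y‖ₑ) (E / ε ^ n) (by positivity) hb
        _ ≤ ENNReal.ofReal (E / ε ^ n * (C * ε ^ n / ε)) +
            ENNReal.ofReal |C₀| * ENNReal.ofReal D := by gcongr
        _ ≤ _ := by
          rw [← ENNReal.ofReal_mul (by positivity), ← ENNReal.ofReal_add (by positivity)
            (by positivity)]
          apply ENNReal.ofReal_le_ofReal
          have e1 : E / ε ^ n * (C * ε ^ n / ε) = E * C / ε := by field_simp
          have e2 : |C₀| * D ≤ |C₀| * D / ε := by
            rw [le_div_iff₀ hε]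
            have : 0 ≤ |C₀| * D := by positivity
            nlinarith
          have e3 : 0 ≤ 1 / ε := by positivity
          rw [e1, add_div, add_div]
          linarith
    have hmeas : Measurable fun y => χ ε x y * F (P y) :=
      ((hχ.measurable ε hmem).comp measurable_prodMk_left).mul hFP
    refine ⟨⟨hmeas.aestronglyMeasurable, hmain.trans_lt ENNReal.ofReal_lt_top⟩, ?_⟩
    have h5 := (enorm_integral_le_lintegral_enorm (fun y => χ ε x y * F (P y))).trans hmain
    rw [← ofReal_norm, ENNReal.ofReal_le_ofReal_iff (by positivity)] at h5
    exact h5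
end

section
/- Let n ≥ 2 and let χ : ℝⁿ → ℂ be a Schwartz function, with χ_ε(x) = ε^{−n} χ(x/ε). For ρ ∈ ℂⁿ, define g_ρ : ℝⁿ → ℂ by g_ρ(ξ) = 1/(−ξ·ξ − 2i ρ·ξ) (defined off its zero set). There exist constants C > 0 and r > 0, depending only on n and χ, such that for every ρ ∈ ℂⁿ with ρ·ρ = 0 and |ρ| > r, and every ε ∈ (0,1], the function g_ρ is locally integrable and the convolution satisfies ‖χ_ε ∗ g_ρ‖_{L^∞(ℝⁿ)} ≤ C/(ε|ρ|). -/
open MeasureTheory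
open scoped ENNReal

lemma fub {n : ℕ} (i : Fin (n+1)) (A : ℝ × (Fin n → ℝ) → ℝ≥0∞) (hA : Measurable A) :
    ∫⁻ ξ : Fin (n+1) → ℝ, A (ξ i, fun k => ξ (i.succAbove k)) = ∫⁻ z : Fin n → ℝ, ∫⁻ t : ℝ, A (t, z) := by
  have h := (volume_preserving_piFinSuccAbove (fun _ : Fin (n+1) => ℝ) i).lintegral_comp hA
  rw [Measure.volume_eq_prod, lintegral_prod_symm _ hA.aemeasurable] at h
  exact h

lemma prodBound (K : ℝ≥0∞) : ∀ {n : ℕ} (f : Fin n → ℝ → ℝ≥0∞) (_ : ∀ k, Measurable (f k))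
    (_ : ∀ k, ∫⁻ t, f k t ≤ K), ∫⁻ ξ : Fin n → ℝ, ∏ k, f k (ξ k) ≤ K ^ n := by
  intro n
  induction n with
  | zero => intro f hf hK; simp [volume_pi]
  | succ n ih =>
    intro f hf hK
    have h := fub (0 : Fin (n+1)) (fun p => f 0 p.1 * ∏ k : Fin n, f k.succ (p.2 k))
      (by fun_prop)
    simp only [Fin.prod_univ_succ]
    simp only [Fin.succAbove_zero] at h
    rw [h]
    calc _ = ∫⁻ z : Fin n → ℝ, (∫⁻ t, f 0 t) * ∏ k : Fin n, f k.succ (z k) := by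
            congr 1; ext z
            rw [lintegral_mul_const _ (hf 0)]
      _ ≤ ∫⁻ z : Fin n → ℝ, K * ∏ k : Fin n, f k.succ (z k) := by
            gcongr; exact hK 0
      _ = K * ∫⁻ z : Fin n → ℝ, ∏ k : Fin n, f k.succ (z k) := by
            rw [lintegral_const_mul]; fun_prop
      _ ≤ K * K ^ n := by
            gcongr; exact ih _ (fun k => hf _) (fun k => hK _)
      _ = K ^ (n+1) := by ring

noncomputable def wt (t : ℝ) : ℝ≥0∞ := ENNReal.ofReal ((1 + t^2)⁻¹)
noncomputable def kap (t : ℝ) : ℝ≥0∞ := (ENNReal.ofReal (√|t|))⁻¹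

lemma wt_meas : Measurable wt := by unfold wt; fun_prop
lemma kap_meas : Measurable kap := by unfold kap; fun_prop

lemma wt_le (t : ℝ) : wt t ≤ 1 := by
  unfold wt
  rw [ENNReal.ofReal_le_one]
  exact inv_le_one_of_one_le₀ (by nlinarith [sq_nonneg t])

lemma wt_int : ∫⁻ t, wt t < ∞ := by
  have h := integrable_inv_one_add_sq.lintegral_lt_top
  exact h

lemma kap_int : ∫⁻ t in Set.Icc (-1:ℝ) 1, kap t < ∞ := by
  have h1 : IntervalIntegrable (fun t : ℝ => t ^ (-(1/2) : ℝ)) volume 0 1 :=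
    intervalIntegral.intervalIntegrable_rpow' (by norm_num)
  have h2 : IntegrableOn (fun t : ℝ => t ^ (-(1/2) : ℝ)) (Set.Ioc 0 1) volume :=
    (intervalIntegrable_iff_integrableOn_Ioc_of_le zero_le_one).1 h1
  have h3 : ∫⁻ t in Set.Ioc (0:ℝ) 1, kap t < ∞ := by
    refine lt_of_le_of_lt (le_of_eq ?_) h2.lintegral_lt_top
    refine setLIntegral_congr_fun measurableSet_Ioc ?_
    intro t ht
    simp only [kap]
    rw [← ENNReal.ofReal_inv_of_pos (Real.sqrt_pos.2 (abs_pos.2 ht.1.ne')), abs_of_pos ht.1,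
      Real.sqrt_eq_rpow, Real.rpow_neg ht.1.le]
  have h4 : ∫⁻ t in Set.Ico (-1:ℝ) 0, kap t < ∞ := by
    have := (Measure.measurePreserving_neg (volume : Measure ℝ)).setLIntegral_comp_preimage
      (s := Set.Ioc (0:ℝ) 1) measurableSet_Ioc kap_meas
    have e : ∀ a, kap (-a) = kap a := by intro a; simp [kap]
    simp only [e] at this
    have e2 : (Neg.neg ⁻¹' Set.Ioc (0:ℝ) 1) = Set.Ico (-1:ℝ) 0 := by ext x; simp
    rw [e2] at this
    rw [this]; exact h3
  have e : Set.Icc (-1:ℝ) 1 ⊆ (Set.Ico (-1:ℝ) 0 ∪ Set.Ioc (0:ℝ) 1) ∪ {0} := by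
    intro x hx
    rcases lt_trichotomy x 0 with h | h | h
    · exact Or.inl (Or.inl ⟨hx.1, h⟩)
    · exact Or.inr h
    · exact Or.inl (Or.inr ⟨h, hx.2⟩)
  refine lt_of_le_of_lt (lintegral_mono_set e) ?_
  refine lt_of_le_of_lt (lintegral_union_le _ _ _) ?_
  refine ENNReal.add_lt_top.2 ⟨lt_of_le_of_lt (lintegral_union_le _ _ _) (ENNReal.add_lt_top.2 ⟨h4, h3⟩), ?_⟩
  simp

lemma one_dim : ∃ K : ℝ≥0∞, K < ∞ ∧ (∀ y : ℝ, ∫⁻ t, wt (y - t) ≤ K) ∧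
    ∀ y z : ℝ, ∫⁻ t, wt (y - t) * kap (t - z) ≤ K := by
  have hw : ∀ y : ℝ, ∫⁻ t, wt (y - t) = ∫⁻ t, wt t := fun y => lintegral_sub_left_eq_self wt y
  refine ⟨(∫⁻ t, wt t) + ∫⁻ t in Set.Icc (-1:ℝ) 1, kap t, ENNReal.add_lt_top.2 ⟨wt_int, kap_int⟩,
    fun y => (hw y).le.trans le_self_add, fun y z => ?_⟩
  have hm : Measurable fun t => wt (y - t) := wt_meas.comp (by fun_prop)
  calc ∫⁻ t, wt (y - t) * kap (t - z)
      ≤ ∫⁻ t, (wt (y - t) + (Set.Icc (-1:ℝ) 1).indicator kap (t - z)) := by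
        refine lintegral_mono fun t => ?_
        by_cases h : t - z ∈ Set.Icc (-1:ℝ) 1
        · simp only [Set.indicator_of_mem h]
          exact le_add_left (mul_le_of_le_one_left' (wt_le _))
        · simp only [Set.indicator_of_notMem h, add_zero]
          refine mul_le_of_le_one_right' ?_
          unfold kap
          rw [ENNReal.inv_le_one, ENNReal.one_le_ofReal, Real.one_le_sqrt]
          by_contra hh
          push Not at hh
          exact h ⟨(abs_lt.1 hh).1.le, (abs_lt.1 hh).2.le⟩
    _ = _ := by
        rw [lintegral_add_left hm, hw, lintegral_sub_right_eq_self ((Set.Icc (-1:ℝ) 1).indicator kap) z,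
          lintegral_indicator measurableSet_Icc]

lemma oneVar (w M s : ℝ) (m c : ℝ) (hc : 0 ≤ c * s) (hM : M = √m) (hw : c * s ≤ |w|) :
    c * s * |w - M| ≤ |w^2 - m| ∨ c * s * |w + M| ≤ |w^2 - m| := by
  have hM0 : 0 ≤ M := hM ▸ Real.sqrt_nonneg m
  have key : c * s * |(|w|) - M| ≤ |w^2 - m| := by
    rcases le_total 0 m with h | h
    · have : m = M^2 := by rw [hM, Real.sq_sqrt h]
      rw [this, ← sq_abs w, sq_sub_sq, abs_mul]
      gcongr
      rw [abs_of_nonneg (by positivity)]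
      linarith
    · have : M = 0 := by rw [hM, Real.sqrt_eq_zero_of_nonpos h]
      rw [this, sub_zero, abs_abs, abs_of_nonneg (a := w^2 - m) (by nlinarith [sq_nonneg w])]
      have := mul_le_mul_of_nonneg_right hw (abs_nonneg w)
      nlinarith [sq_abs w, abs_nonneg w]
  rcases abs_cases w with ⟨h, _⟩ | ⟨h, _⟩
  · left; rwa [h] at key
  · right
    rw [h] at key
    rwa [show |w + M| = |-w - M| by rw [← abs_neg]; ring_nf]

lemma recip_bound (D s c t u : ℝ) (hs : 0 < s) (hc : 0 < c) (hc1 : c ≤ 1) (h1 : s * |t| ≤ D)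
    (h2 : c * s * |u| ≤ D) :
    ENNReal.ofReal D⁻¹ ≤ ENNReal.ofReal (1 / (c * s)) * (kap t * kap u) := by
  have hne : ENNReal.ofReal (1 / (c * s)) ≠ 0 := by
    rw [Ne, ENNReal.ofReal_eq_zero, not_le]; positivity
  have hk : ∀ v, kap v ≠ 0 := fun v => by simp [kap]
  by_cases ht : t = 0
  · have : kap t = ∞ := by simp [kap, ht]
    rw [this, ENNReal.top_mul (hk u), ENNReal.mul_top hne]; exact le_top
  by_cases hu : u = 0
  · have : kap u = ∞ := by simp [kap, hu]
    rw [this, ENNReal.mul_top (hk t), ENNReal.mul_top hne]; exact le_top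
  have ht' := abs_pos.2 ht
  have hu' := abs_pos.2 hu
  unfold kap
  have p1 : 0 < √|t| := Real.sqrt_pos.2 ht'
  have p2 : 0 < √|u| := Real.sqrt_pos.2 hu'
  rw [← ENNReal.ofReal_inv_of_pos p1, ← ENNReal.ofReal_inv_of_pos p2,
    ← ENNReal.ofReal_mul (by positivity), ← ENNReal.ofReal_mul (by positivity)]
  apply ENNReal.ofReal_le_ofReal
  rw [one_div, ← mul_inv, ← mul_inv]
  apply inv_anti₀ (by positivity)
  have hD : 0 ≤ D := le_trans (by positivity) h1
  apply le_of_sq_le_sq _ hD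
  rw [mul_pow, mul_pow (√|t|), Real.sq_sqrt ht'.le, Real.sq_sqrt hu'.le]
  calc (c * s)^2 * (|t| * |u|) = c * ((s * |t|) * (c * s * |u|)) := by ring
    _ ≤ 1 * ((s * |t|) * (c * s * |u|)) := by gcongr
    _ ≤ 1 * (D * D) := by gcongr
    _ = D^2 := by ring

/-- radius coordinate -/
noncomputable def Mf {n : ℕ} (s : ℝ) (z : Fin n → ℝ) : ℝ := √(s^2 - ∑ k, z k ^ 2)

lemma pointwise {m : ℕ} (s : ℝ) (hs : 1/2 < s) (ζ : Fin (m+2) → ℝ) (D : ℝ)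
    (h1 : 2 * s * |ζ 0| ≤ D) (h2 : |∑ k, ζ k ^ 2 - s^2| ≤ D) :
    ENNReal.ofReal D⁻¹ ≤ ENNReal.ofReal (4 * (m+2) / s) * (1 + ∑ j : Fin (m+1),
      (kap (ζ 0) * kap (ζ j.succ - Mf s (fun k => ζ (j.succ.succAbove k))) +
       kap (ζ 0) * kap (ζ j.succ + Mf s (fun k => ζ (j.succ.succAbove k))))) := by
  have hs0 : 0 < s := by linarith
  set c : ℝ := 1 / (2 * (m + 2)) with hc
  have hcpos : 0 < c := by positivity
  have hc1 : c ≤ 1 := by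
    rw [hc, div_le_one (by positivity)]; have : (0:ℝ) ≤ m := by positivity
    linarith
  have hcs : ENNReal.ofReal (1 / (c * s)) ≤ ENNReal.ofReal (4 * (m+2) / s) := by
    apply ENNReal.ofReal_le_ofReal
    rw [hc]
    have : 1 / (1 / (2 * ((m:ℝ) + 2)) * s) = 2 * (m+2) / s := by field_simp
    rw [this]; gcongr; norm_num
  have h1' : s * |ζ 0| ≤ D := by nlinarith [abs_nonneg (ζ 0), mul_nonneg hs0.le (abs_nonneg (ζ 0))]
  by_cases hA : ∃ j : Fin (m+1), c * s ≤ |ζ j.succ|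
  · obtain ⟨j, hj⟩ := hA
    have e : ∑ k, ζ k ^ 2 - s^2 = ζ j.succ ^ 2 - (s^2 - ∑ k, (fun k => ζ (j.succ.succAbove k)) k ^ 2) := by
      rw [Fin.sum_univ_succAbove _ j.succ]; ring
    rw [e] at h2
    have hb : ENNReal.ofReal D⁻¹ ≤ ENNReal.ofReal (1 / (c * s)) *
      (kap (ζ 0) * kap (ζ j.succ - Mf s (fun k => ζ (j.succ.succAbove k))) +
       kap (ζ 0) * kap (ζ j.succ + Mf s (fun k => ζ (j.succ.succAbove k)))) := by
      rcases oneVar (ζ j.succ) (Mf s (fun k => ζ (j.succ.succAbove k))) s _ c (by positivity) rfl hj with h | h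
      · exact (recip_bound D s c _ _ hs0 hcpos hc1 h1' (h.trans h2)).trans (by gcongr; exact le_self_add)
      · exact (recip_bound D s c _ _ hs0 hcpos hc1 h1' (h.trans h2)).trans (by gcongr; exact le_add_self)
    refine hb.trans ?_
    refine mul_le_mul' hcs ?_
    refine le_trans ?_ le_add_self
    exact Finset.single_le_sum (f := fun j : Fin (m+1) => (kap (ζ 0) * kap (ζ j.succ - Mf s (fun k => ζ (j.succ.succAbove k))) +
       kap (ζ 0) * kap (ζ j.succ + Mf s (fun k => ζ (j.succ.succAbove k))))) (fun _ _ => zero_le) (Finset.mem_univ j)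
  · push Not at hA
    have hD : s^2 / 2 ≤ D := by
      rcases le_total (s/2) |ζ 0| with h | h
      · nlinarith
      · have hz : ζ 0 ^ 2 ≤ s^2/4 := by rw [← sq_abs]; nlinarith [abs_nonneg (ζ 0)]
        have hsum : ∑ j : Fin (m+1), ζ j.succ ^ 2 ≤ ∑ j : Fin (m+1), (c*s)^2 := by
          refine Finset.sum_le_sum fun j _ => ?_
          rw [← sq_abs]; have := (hA j).le
          gcongr
        have h3 : ∑ j : Fin (m+1), (c*s)^2 ≤ s^2/4 := by
          simp only [Finset.sum_const, Finset.card_univ, Fintype.card_fin, nsmul_eq_mul]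
          push_cast
          rw [mul_pow, hc, div_pow, one_pow]
          have hm : (0:ℝ) ≤ m := by positivity
          have : ((m:ℝ)+1) * (1 / (2*(m+2))^2) ≤ 1/4 := by
            rw [mul_one_div, div_le_div_iff₀ (by positivity) (by positivity)]; nlinarith
          nlinarith [sq_nonneg s]
        rw [Fin.sum_univ_succ] at h2
        have := (abs_le.1 h2).1
        linarith
    refine le_trans ?_ (mul_le_mul_right (le_self_add : (1:ℝ≥0∞) ≤ _) _)
    rw [mul_one]
    apply ENNReal.ofReal_le_ofReal
    have hm : (0:ℝ) ≤ m := by positivity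
    calc D⁻¹ ≤ (s^2/2)⁻¹ := inv_anti₀ (by positivity) hD
      _ = (2 / s) / s := by field_simp
      _ ≤ (4 * (m+2)) / s := by
        gcongr
        rw [div_le_iff₀ hs0]; nlinarith

lemma core (m : ℕ) : ∃ K : ℝ≥0∞, K < ∞ ∧ ∀ (s : ℝ) (_ : 1/2 < s) (y : Fin (m+2) → ℝ)
    (D : (Fin (m+2) → ℝ) → ℝ) (_ : ∀ ζ, 2 * s * |ζ 0| ≤ D ζ) (_ : ∀ ζ, |∑ k, ζ k ^ 2 - s^2| ≤ D ζ),
    ∫⁻ ζ : Fin (m+2) → ℝ, (∏ k, wt (y k - ζ k)) * ENNReal.ofReal (D ζ)⁻¹ ≤ ENNReal.ofReal (1 / s) * K := by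
  obtain ⟨K, hK, hw, hk⟩ := one_dim
  refine ⟨ENNReal.ofReal (4 * (m+2)) * (K^(m+2) + ∑ j : Fin (m+1), (K^(m+2) + K^(m+2))), ?_, ?_⟩
  · refine ENNReal.mul_lt_top ENNReal.ofReal_lt_top (ENNReal.add_lt_top.2 ⟨ENNReal.pow_lt_top hK, ?_⟩)
    refine ENNReal.sum_lt_top.2 fun _ _ => ENNReal.add_lt_top.2 ⟨ENNReal.pow_lt_top hK, ENNReal.pow_lt_top hK⟩
  intro s hs y D h1 h2
  have mw := wt_meas
  have mk := kap_meas
  have hM : Measurable (Mf s : (Fin (m+1) → ℝ) → ℝ) := by unfold Mf; fun_prop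
  have one : ∀ (j : Fin (m+1)) (N : (Fin (m+1) → ℝ) → ℝ), Measurable N →
      ∫⁻ ζ : Fin (m+2) → ℝ, (∏ k, wt (y k - ζ k)) * (kap (ζ 0) * kap (ζ j.succ - N (fun k => ζ (j.succ.succAbove k)))) ≤ K^(m+2) := by
    intro j N hN
    have h := fub j.succ (fun p => (wt (y j.succ - p.1) * kap (p.1 - N p.2)) * ((∏ k, wt (y (j.succ.succAbove k) - p.2 k)) * kap (p.2 0)))
      (by fun_prop)
    simp only [Fin.succ_succAbove_zero] at h
    calc _ = _ := by
            refine Eq.trans (lintegral_congr fun ζ => ?_) h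
            rw [Fin.prod_univ_succAbove _ j.succ]; ring
      _ ≤ ∫⁻ z : Fin (m+1) → ℝ, K * ((∏ k, wt (y (j.succ.succAbove k) - z k)) * kap (z 0)) := by
            refine lintegral_mono fun z => ?_
            rw [lintegral_mul_const _ (by fun_prop)]
            gcongr
            exact hk _ _
      _ = K * ∫⁻ z : Fin (m+1) → ℝ, ((∏ k, wt (y (j.succ.succAbove k) - z k)) * kap (z 0)) := by
            rw [lintegral_const_mul _ (by fun_prop)]
      _ = K * ∫⁻ z : Fin (m+1) → ℝ, ∏ k, (Fin.cons (fun t => wt (y (j.succ.succAbove 0) - t) * kap (t - 0))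
              (fun k t => wt (y (j.succ.succAbove k.succ) - t)) : Fin (m+1) → ℝ → ℝ≥0∞) k (z k) := by
            congr 1
            refine lintegral_congr fun z => ?_
            simp only [Fin.prod_univ_succ, Fin.cons_zero, Fin.cons_succ, sub_zero]
            ring
      _ ≤ K * K^(m+1) := by
            gcongr
            refine prodBound K _ (fun k => ?_) (fun k => ?_)
            · refine Fin.cases ?_ (fun k => ?_) k
              · simp only [Fin.cons_zero]; fun_prop
              · simp only [Fin.cons_succ]; fun_prop
            · refine Fin.cases ?_ (fun k => ?_) k
              · simp only [Fin.cons_zero]; exact hk _ _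
              · simp only [Fin.cons_succ]; exact hw _
      _ = K^(m+2) := by ring
  calc _ ≤ ∫⁻ ζ : Fin (m+2) → ℝ, ENNReal.ofReal (4 * (m+2) / s) * ((∏ k, wt (y k - ζ k)) + ∑ j : Fin (m+1),
      ((∏ k, wt (y k - ζ k)) * (kap (ζ 0) * kap (ζ j.succ - Mf s (fun k => ζ (j.succ.succAbove k)))) +
       (∏ k, wt (y k - ζ k)) * (kap (ζ 0) * kap (ζ j.succ - (- Mf s (fun k => ζ (j.succ.succAbove k))))))) := by
        refine lintegral_mono fun ζ => ?_
        refine (mul_le_mul_right (pointwise s hs ζ (D ζ) (h1 ζ) (h2 ζ)) _).trans (le_of_eq ?_)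
        simp only [sub_neg_eq_add, ← mul_add, ← Finset.mul_sum]
        rw [mul_left_comm, mul_add (∏ k, wt (y k - ζ k)), mul_one]
    _ = ENNReal.ofReal (4 * (m+2) / s) * ((∫⁻ ζ : Fin (m+2) → ℝ, ∏ k, wt (y k - ζ k)) + ∑ j : Fin (m+1),
      ((∫⁻ ζ : Fin (m+2) → ℝ, (∏ k, wt (y k - ζ k)) * (kap (ζ 0) * kap (ζ j.succ - Mf s (fun k => ζ (j.succ.succAbove k))))) +
       ∫⁻ ζ : Fin (m+2) → ℝ, (∏ k, wt (y k - ζ k)) * (kap (ζ 0) * kap (ζ j.succ - (- Mf s (fun k => ζ (j.succ.succAbove k))))))) := by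
        rw [lintegral_const_mul _ (by fun_prop), lintegral_add_left (by fun_prop), lintegral_finsetSum _ (by fun_prop)]
        congr 2
        refine Finset.sum_congr rfl fun j _ => ?_
        rw [lintegral_add_left (by fun_prop)]
    _ ≤ ENNReal.ofReal (4 * (m+2) / s) * (K^(m+2) + ∑ j : Fin (m+1), (K^(m+2) + K^(m+2))) := by
        gcongr with j
        · exact prodBound K (fun k t => wt (y k - t)) (fun k => by fun_prop) (fun k => hw _)
        · exact one j _ hM
        · exact one j (fun z => - Mf s z) hM.neg
    _ = _ := by
        rw [← mul_assoc, ← ENNReal.ofReal_mul (by positivity)]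
        congr 2
        ring

noncomputable def sy {n : ℕ} (ρ : EuclideanSpace ℂ (Fin n)) (ξ : Fin n → ℝ) : ℂ :=
  -(∑ j, (ξ j : ℂ) * (ξ j : ℂ)) - 2 * Complex.I * ∑ j, ρ j * (ξ j : ℂ)

lemma sy_re {n : ℕ} (ρ : EuclideanSpace ℂ (Fin n)) (ξ : Fin n → ℝ) :
    (sy ρ ξ).re = -∑ j, ξ j ^ 2 + 2 * ∑ j, (ρ j).im * ξ j := by
  simp [sy, Complex.re_sum, Complex.im_sum, pow_two]

lemma sy_im {n : ℕ} (ρ : EuclideanSpace ℂ (Fin n)) (ξ : Fin n → ℝ) :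
    (sy ρ ξ).im = -(2 * ∑ j, (ρ j).re * ξ j) := by
  simp [sy, Complex.re_sum, Complex.im_sum]

lemma sy_meas {n : ℕ} (ρ : EuclideanSpace ℂ (Fin n)) : Measurable (sy ρ) := by
  unfold sy; fun_prop

lemma wt_prod {n : ℕ} (u : Fin n → ℝ) :
    ENNReal.ofReal (((1 + ∑ k, u k ^ 2)⁻¹) ^ n) ≤ ∏ k, wt (u k) := by
  unfold wt
  rw [← ENNReal.ofReal_prod_of_nonneg (fun i _ => by positivity)]
  apply ENNReal.ofReal_le_ofReal
  calc ((1 + ∑ k, u k ^ 2)⁻¹) ^ n = ∏ k : Fin n, (1 + ∑ k, u k ^ 2)⁻¹ := by simp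
    _ ≤ _ := by
      refine Finset.prod_le_prod (fun i _ => by positivity) fun i _ => ?_
      apply inv_anti₀ (by positivity)
      gcongr
      exact Finset.single_le_sum (f := fun k => u k ^ 2) (fun _ _ => sq_nonneg _) (Finset.mem_univ i)

lemma rotated (m : ℕ) : ∃ K : ℝ≥0∞, K < ∞ ∧ ∀ (ρ : EuclideanSpace ℂ (Fin (m+2)))
    (_ : ∑ j, ρ j ^ 2 = 0) (_ : 1 < ‖ρ‖) (x : Fin (m+2) → ℝ),
    ∫⁻ ξ : Fin (m+2) → ℝ, ENNReal.ofReal (((1 + ∑ k, (x k - ξ k) ^ 2)⁻¹) ^ (m+2)) *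
      ENNReal.ofReal (‖sy ρ ξ‖⁻¹) ≤ ENNReal.ofReal (1 / ‖ρ‖) * K := by
  obtain ⟨K, hK, hcore⟩ := core m
  refine ⟨ENNReal.ofReal 2 * K, ENNReal.mul_lt_top ENNReal.ofReal_lt_top hK, ?_⟩
  intro ρ hρ hr x
  have e1 : ∑ j, (ρ j).re ^ 2 = ∑ j, (ρ j).im ^ 2 := by
    have := congrArg Complex.re hρ
    simp only [Complex.re_sum, pow_two, Complex.mul_re, Complex.zero_re, Finset.sum_sub_distrib] at this
    simp only [pow_two]; linarith
  have e2 : ∑ j, (ρ j).re * (ρ j).im = 0 := by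
    have := congrArg Complex.im hρ
    simp only [Complex.im_sum, pow_two, Complex.mul_im, Complex.zero_im, Finset.sum_add_distrib] at this
    have h' : ∑ j, (ρ j).im * (ρ j).re = ∑ j, (ρ j).re * (ρ j).im := by
      simp only [mul_comm]
    linarith
  have e3 : ‖ρ‖ ^ 2 = ∑ j, (ρ j).re ^ 2 + ∑ j, (ρ j).im ^ 2 := by
    rw [EuclideanSpace.norm_sq_eq, ← Finset.sum_add_distrib]
    refine Finset.sum_congr rfl fun j _ => ?_
    rw [Complex.sq_norm, Complex.normSq_apply]; ring
  let a : EuclideanSpace ℝ (Fin (m+2)) := WithLp.toLp 2 fun j => (ρ j).re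
  let b : EuclideanSpace ℝ (Fin (m+2)) := WithLp.toLp 2 fun j => (ρ j).im
  set s : ℝ := ‖a‖ with hs
  have hs2 : s^2 = ∑ j, (ρ j).re ^ 2 := by
    rw [hs, EuclideanSpace.norm_sq_eq]; simp [a]
  have hs0 : 0 ≤ s := norm_nonneg _
  have hrs : ‖ρ‖^2 = 2 * s^2 := by rw [e3, ← e1, hs2]; ring
  have hs1 : 1/2 < s := by nlinarith
  have hsp : 0 < s := by linarith
  have hon : Orthonormal ℝ (({0} : Set (Fin (m+2))).domRestrict (fun _ => s⁻¹ • a)) := by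
    constructor
    · intro i
      change ‖s⁻¹ • a‖ = 1
      rw [norm_smul, norm_inv, Real.norm_eq_abs, abs_of_pos hsp]
      exact inv_mul_cancel₀ hsp.ne'
    · intro i j hij
      exact absurd (Subsingleton.elim i j) hij
  obtain ⟨B, hB⟩ := hon.exists_orthonormalBasis_extension_of_card_eq (by simp)
  have hB0 : B 0 = s⁻¹ • a := hB 0 rfl
  let V : (Fin (m+2) → ℝ) → EuclideanSpace ℝ (Fin (m+2)) := fun ζ => B.repr.symm (WithLp.toLp 2 ζ)
  let Φ : (Fin (m+2) → ℝ) → (Fin (m+2) → ℝ) := fun ζ => WithLp.ofLp (V ζ + b)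
  have hΦ : MeasurePreserving Φ volume volume :=
    (PiLp.volume_preserving_ofLp _).comp ((measurePreserving_add_right volume b).comp
      (B.measurePreserving_repr_symm.comp (PiLp.volume_preserving_toLp _)))
  have hΦa : ∀ ζ k, Φ ζ k = V ζ k + (ρ k).im := fun ζ k => rfl
  have hV2 : ∀ ζ, ∑ k, V ζ k ^ 2 = ∑ k, ζ k ^ 2 := by
    intro ζ
    have h : ‖V ζ‖ = ‖(WithLp.toLp 2 ζ : EuclideanSpace ℝ (Fin (m+2)))‖ := B.repr.symm.norm_map _
    have h' := congrArg (· ^ 2) h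
    simpa [EuclideanSpace.norm_sq_eq] using h'
  have hV0 : ∀ ζ, ∑ k, (ρ k).re * V ζ k = s * ζ 0 := by
    intro ζ
    have h : B.repr (V ζ) 0 = ζ 0 := by simp [V]
    rw [B.repr_apply_apply, hB0, inner_smul_left] at h
    have h2 : inner ℝ a (V ζ) = ∑ k, (ρ k).re * V ζ k := by
      rw [PiLp.inner_apply]
      refine Finset.sum_congr rfl fun k _ => ?_
      simp [a, mul_comm]
    rw [← h, h2]
    simp; field_simp
  have hre : ∀ ζ, (sy ρ (Φ ζ)).re = -(∑ k, ζ k ^ 2 - s^2) := by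
    intro ζ
    rw [sy_re, ← hV2 ζ, hs2, e1]
    simp only [hΦa, Finset.mul_sum, ← Finset.sum_neg_distrib, ← Finset.sum_sub_distrib, ← Finset.sum_add_distrib]
    refine Finset.sum_congr rfl fun k _ => ?_
    ring
  have him : ∀ ζ, (sy ρ (Φ ζ)).im = -(2 * s * ζ 0) := by
    intro ζ
    rw [sy_im, mul_assoc, ← hV0 ζ]
    simp only [hΦa, mul_add, Finset.sum_add_distrib, e2, add_zero]
  let y := B.repr (WithLp.toLp 2 x - b)
  have hy : ∀ ζ, ∑ k, (x k - Φ ζ k) ^ 2 = ∑ k, (y k - ζ k)^2 := by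
    intro ζ
    have h : ‖B.repr ((WithLp.toLp 2 x - b) - V ζ)‖ = ‖(WithLp.toLp 2 x - b) - V ζ‖ := B.repr.norm_map _
    have h2 : B.repr ((WithLp.toLp 2 x - b) - V ζ) = y - WithLp.toLp 2 ζ := by
      rw [map_sub]; simp [V, y]
    rw [h2] at h
    have h' := congrArg (· ^ 2) h
    simp only [EuclideanSpace.norm_sq_eq, Real.norm_eq_abs, sq_abs] at h'
    refine Eq.trans (Finset.sum_congr rfl fun k _ => ?_) h'.symm
    rw [hΦa]; simp [b]; ring
  have msy := sy_meas ρ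
  rw [← hΦ.lintegral_comp (by fun_prop)]
  calc _ ≤ ∫⁻ ζ : Fin (m+2) → ℝ, (∏ k, wt (y k - ζ k)) * ENNReal.ofReal (‖sy ρ (Φ ζ)‖)⁻¹ := by
        refine lintegral_mono fun ζ => ?_
        rw [hy]
        gcongr
        exact wt_prod (fun k => y k - ζ k)
    _ ≤ ENNReal.ofReal (1 / s) * K := by
        refine hcore s hs1 y (fun ζ => ‖sy ρ (Φ ζ)‖) (fun ζ => ?_) (fun ζ => ?_)
        · have := Complex.abs_im_le_norm (sy ρ (Φ ζ))
          rwa [him, abs_neg, abs_mul, abs_of_pos (by positivity)] at this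
        · have := Complex.abs_re_le_norm (sy ρ (Φ ζ))
          rwa [hre, abs_neg] at this
    _ ≤ _ := by
        rw [← mul_assoc, ← ENNReal.ofReal_mul (by positivity)]
        gcongr
        rw [one_div_mul_eq_div, div_le_div_iff₀ hsp (by linarith)]
        nlinarith

lemma schwartz_decay {n : ℕ} (hn : 1 ≤ n) (χ : SchwartzMap (Fin n → ℝ) ℂ) :
    ∃ A : ℝ, 0 ≤ A ∧ ∀ v, ‖χ v‖ ≤ A * ((1 + ∑ k, v k ^ 2)⁻¹) ^ n := by
  set A0 : ℝ := 2 ^ (2*n) * (Finset.Iic (2*n, 0)).sup (fun m => SchwartzMap.seminorm ℝ m.1 m.2) χ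
  have hA : ∀ v, (1 + ‖v‖) ^ (2*n) * ‖χ v‖ ≤ A0 := fun v => by
    simpa using SchwartzMap.one_add_le_sup_seminorm_apply (𝕜 := ℝ) (m := (2*n, 0)) (k := 2*n) (n := 0)
      le_rfl le_rfl χ v
  have hA0 : 0 ≤ A0 := le_trans (by positivity) (hA 0)
  refine ⟨n^n * A0, by positivity, fun v => ?_⟩
  have hn' : (1:ℝ) ≤ n := by exact_mod_cast hn
  have h1 : 1 + ∑ k, v k ^ 2 ≤ n * (1 + ‖v‖)^2 := by
    have : ∑ k, v k ^ 2 ≤ ∑ k : Fin n, ‖v‖^2 := by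
      refine Finset.sum_le_sum fun k _ => ?_
      rw [← sq_abs]
      gcongr
      exact norm_le_pi_norm v k
    simp only [Finset.sum_const, Finset.card_univ, Fintype.card_fin, nsmul_eq_mul] at this
    nlinarith [norm_nonneg v, mul_nonneg (by linarith : (0:ℝ) ≤ n) (norm_nonneg v)]
  have h2 : (1 + ∑ k, v k ^ 2)^n ≤ n^n * (1 + ‖v‖)^(2*n) := by
    rw [pow_mul, ← mul_pow]
    gcongr
  rw [inv_pow, ← div_eq_mul_inv, le_div_iff₀ (by positivity)]
  calc ‖χ v‖ * (1 + ∑ k, v k ^ 2)^n ≤ ‖χ v‖ * (n^n * (1 + ‖v‖)^(2*n)) := by gcongr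
    _ = n^n * ((1 + ‖v‖)^(2*n) * ‖χ v‖) := by ring
    _ ≤ _ := by gcongr; exact hA v

lemma unit_scale (m : ℕ) (χ : SchwartzMap (Fin (m+2) → ℝ) ℂ) : ∃ C : ℝ, 0 < C ∧
    ∀ (ρ : EuclideanSpace ℂ (Fin (m+2))) (_ : ∑ j, ρ j ^ 2 = 0) (_ : 1 < ‖ρ‖),
      LocallyIntegrable (fun ξ => (sy ρ ξ)⁻¹) ∧ ∀ (x : Fin (m+2) → ℝ),
      Integrable (fun ξ => χ (x - ξ) * (sy ρ ξ)⁻¹) ∧ ‖∫ ξ, χ (x - ξ) * (sy ρ ξ)⁻¹‖ ≤ C / ‖ρ‖ := by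
  obtain ⟨K, hK, hrot⟩ := rotated m
  obtain ⟨A, hA0, hA⟩ := schwartz_decay (by omega) χ
  refine ⟨A * K.toReal + 1, by positivity, fun ρ hρ hr => ?_⟩
  have msy := sy_meas ρ
  refine ⟨?_, fun x => ?_⟩
  · have hi : Integrable (fun ξ : Fin (m+2) → ℝ =>
        (((((1 + ∑ k, ξ k ^ 2)⁻¹) ^ (m+2) : ℝ)) : ℂ) * (sy ρ ξ)⁻¹) := by
      refine ⟨Measurable.aestronglyMeasurable (by fun_prop), ?_⟩
      rw [hasFiniteIntegral_iff_norm]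
      refine lt_of_le_of_lt (le_trans (le_of_eq ?_) (hrot ρ hρ hr 0))
        (ENNReal.mul_lt_top ENNReal.ofReal_lt_top hK)
      refine lintegral_congr fun ξ => ?_
      rw [norm_mul, ENNReal.ofReal_mul (norm_nonneg _), norm_inv, Complex.norm_real, Real.norm_eq_abs,
        abs_of_nonneg (by positivity)]
      simp
    have hl := hi.locallyIntegrable.continuous_mul (g := fun ξ : Fin (m+2) → ℝ =>
      (((((1 + ∑ k, ξ k ^ 2)) ^ (m+2) : ℝ)) : ℂ)) (by fun_prop)
    convert hl using 2 with ξ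
    have : (1 + ∑ k, ξ k ^ 2 : ℝ) ≠ 0 := by positivity
    rw [← mul_assoc, ← Complex.ofReal_mul, ← mul_pow, mul_inv_cancel₀ this]
    simp
  · have hb : ∫⁻ ξ, ENNReal.ofReal ‖χ (x - ξ) * (sy ρ ξ)⁻¹‖ ≤
        ENNReal.ofReal A * (ENNReal.ofReal (1 / ‖ρ‖) * K) := by
      refine le_trans ?_ (mul_le_mul_right (hrot ρ hρ hr x) _)
      rw [← lintegral_const_mul _ (by fun_prop)]
      refine lintegral_mono fun ξ => ?_
      rw [norm_mul, norm_inv, ENNReal.ofReal_mul (norm_nonneg _), ← mul_assoc]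
      gcongr
      rw [← ENNReal.ofReal_mul hA0]
      exact ENNReal.ofReal_le_ofReal (hA (x - ξ))
    have hfin : ENNReal.ofReal A * (ENNReal.ofReal (1 / ‖ρ‖) * K) < ∞ :=
      ENNReal.mul_lt_top ENNReal.ofReal_lt_top (ENNReal.mul_lt_top ENNReal.ofReal_lt_top hK)
    have mχ : Measurable χ := χ.continuous.measurable
    refine ⟨⟨Measurable.aestronglyMeasurable (by fun_prop), ?_⟩, ?_⟩
    · rw [hasFiniteIntegral_iff_norm]
      exact hb.trans_lt hfin
    · refine (norm_integral_le_lintegral_norm _).trans ?_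
      refine (ENNReal.toReal_mono hfin.ne hb).trans ?_
      rw [ENNReal.toReal_mul, ENNReal.toReal_mul, ENNReal.toReal_ofReal hA0,
        ENNReal.toReal_ofReal (by positivity)]
      rw [show A * (1 / ‖ρ‖ * K.toReal) = A * K.toReal / ‖ρ‖ by ring]
      gcongr
      linarith

lemma sy_scale {n : ℕ} (ρ : EuclideanSpace ℂ (Fin n)) (ξ : Fin n → ℝ) (ε : ℝ) (hε : ε ≠ 0) :
    sy ρ ξ = (ε : ℂ)^2 * sy ((ε⁻¹ : ℂ) • ρ) (ε⁻¹ • ξ) := by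
  have : (ε : ℂ) ≠ 0 := by exact_mod_cast hε
  simp only [sy, mul_sub, mul_neg, Finset.mul_sum]
  congr 1
  · congr 1
    refine Finset.sum_congr rfl fun k _ => ?_
    simp; field_simp
  · refine Finset.sum_congr rfl fun k _ => ?_
    simp; field_simp

theorem mollified_symbol_estimate
    (n : ℕ) (hn : 2 ≤ n) (χ : SchwartzMap (Fin n → ℝ) ℂ) :
    ∃ C > (0 : ℝ), ∃ r > (0 : ℝ), ∀ ρ : EuclideanSpace ℂ (Fin n),
      (∑ j, ρ j ^ 2) = 0 → r < ‖ρ‖ →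
      LocallyIntegrable
        (fun ξ : Fin n → ℝ =>
          (-(∑ j, (ξ j : ℂ) * (ξ j : ℂ)) - 2 * Complex.I * ∑ j, ρ j * (ξ j : ℂ))⁻¹) ∧
      ∀ ε ∈ Set.Ioc (0 : ℝ) 1, ∀ x : Fin n → ℝ,
        Integrable
          (fun ξ : Fin n → ℝ => ((ε ^ n : ℝ) : ℂ)⁻¹ * χ (ε⁻¹ • (x - ξ)) *
            (-(∑ j, (ξ j : ℂ) * (ξ j : ℂ)) - 2 * Complex.I * ∑ j, ρ j * (ξ j : ℂ))⁻¹) ∧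
        ‖∫ ξ : Fin n → ℝ, ((ε ^ n : ℝ) : ℂ)⁻¹ * χ (ε⁻¹ • (x - ξ)) *
            (-(∑ j, (ξ j : ℂ) * (ξ j : ℂ)) - 2 * Complex.I * ∑ j, ρ j * (ξ j : ℂ))⁻¹‖ ≤
          C / (ε * ‖ρ‖) := by
  obtain ⟨m, rfl⟩ : ∃ m, n = m + 2 := ⟨n - 2, by omega⟩
  obtain ⟨C, hC, hu⟩ := unit_scale m χ
  refine ⟨C, hC, 1, one_pos, fun ρ hρ hr => ⟨(hu ρ hρ hr).1, ?_⟩⟩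
  rintro ε ⟨hε, hε1⟩ x
  have hεc : (ε : ℂ) ≠ 0 := by exact_mod_cast hε.ne'
  have hρ' : ∑ j, ((ε⁻¹ : ℂ) • ρ) j ^ 2 = 0 := by
    simp only [PiLp.smul_apply, smul_eq_mul, mul_pow, ← Finset.mul_sum, hρ, mul_zero]
  have hnorm : ‖((ε⁻¹ : ℂ) • ρ)‖ = ‖ρ‖ / ε := by
    rw [norm_smul, norm_inv, Complex.norm_real, Real.norm_eq_abs, abs_of_pos hε]; ring
  have hr' : 1 < ‖((ε⁻¹ : ℂ) • ρ)‖ := by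
    rw [hnorm, lt_div_iff₀ hε]; linarith
  obtain ⟨hi, hb⟩ := (hu _ hρ' hr').2 (ε⁻¹ • x)
  set F : (Fin (m+2) → ℝ) → ℂ := fun η => χ (ε⁻¹ • x - η) * (sy ((ε⁻¹ : ℂ) • ρ) η)⁻¹ with hF
  have key : (fun ξ : Fin (m+2) → ℝ => ((ε ^ (m+2) : ℝ) : ℂ)⁻¹ * χ (ε⁻¹ • (x - ξ)) *
            (-(∑ j, (ξ j : ℂ) * (ξ j : ℂ)) - 2 * Complex.I * ∑ j, ρ j * (ξ j : ℂ))⁻¹) =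
      fun ξ => (((ε ^ (m+2) : ℝ) : ℂ)⁻¹ * ((ε : ℂ)^2)⁻¹) * F (ε⁻¹ • ξ) := by
    ext ξ
    change _ * (sy ρ ξ)⁻¹ = _
    rw [sy_scale ρ ξ ε hε.ne', hF, smul_sub, mul_inv]
    ring
  rw [key]
  refine ⟨((hi.comp_smul (inv_ne_zero hε.ne')).const_mul _), ?_⟩
  rw [integral_const_mul, Measure.integral_comp_inv_smul_of_nonneg volume F hε.le]
  rw [norm_mul, norm_smul, norm_mul, norm_inv, norm_inv, Complex.norm_real, norm_pow, norm_pow, norm_pow,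
    Complex.norm_real, Real.norm_eq_abs, abs_of_pos hε, Module.finrank_fin_fun]
  calc _ ≤ (ε ^ (m+2))⁻¹ * (ε^2)⁻¹ * (ε^(m+2) * (C / (‖ρ‖ / ε))) := by
        rw [← hnorm]; gcongr
    _ = _ := by
        have : ‖ρ‖ ≠ 0 := by linarith
        field_simp
end
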